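/- It is undecidable, given two VAS V₁ and V₂, whether their refined covers with respect to the ordering ≤₁ coincide: Cover_{≤₁}(V₁) = Cover_{≤₁}(V₂), where ≤₁ requires equality on the first component and the pointwise order on the others. -/

import Mathlib

/-- A concrete, encodable representation of a VAS: the dimension, the list of action
displacements, and the initial state. States are represented as functions `ℕ → ℕ`
that are only meaningful (and can only change) on components `< dim`. -/
abbrev VRep := ℕ × List (List ℤ) × List ℕ

/-- The displacement of the `a`-th action on component `i` (zero outside the dimension). -/
def VRep.rule (R : VRep) (a i : ℕ) : ℤ :=
  if i < R.1 then (R.2.1.getD a []).getD i 0 else 0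

/-- The initial state. -/
def VRep.initSt (R : VRep) (i : ℕ) : ℕ := if i < R.1 then R.2.2.getD i 0 else 0

/-- One transition step: some action translates the (nonnegative) state. -/
def VRep.Step (R : VRep) (x y : ℕ → ℕ) : Prop :=
  ∃ a < R.2.1.length, ∀ i, (y i : ℤ) = x i + R.rule a i

/-- The reachability set of the represented VAS. -/
def VRep.Reach (R : VRep) : Set (ℕ → ℕ) :=
  {y | Relation.ReflTransGen R.Step R.initSt y}

/-- The refined cover with respect to `≤₁`: downward closure of the reachability set
where the first component must be matched exactly. -/
def VRep.Cover1 (R : VRep) : Set (ℕ → ℕ) :=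
  {x | ∃ y ∈ R.Reach, x 0 = y 0 ∧ ∀ i, x i ≤ y i}

namespace CounterVAS

open Function Relation

/-! ### Nondeterministic counter programs -/

/-- The elementary actions on a counter: increment, decrement, zero test, and no operation. -/
inductive Kind
  | inc | dec | tst | nop
  deriving DecidableEq

instance : Fintype Kind where
  elems := {.inc, .dec, .tst, .nop}
  complete k := by cases k <;> decide

/-- The effect of an elementary action on the value of its counter. -/
def Kind.Rel : Kind → ℕ → ℕ → Prop
  | .inc, a, b => b = a + 1
  | .dec, a, b => a = b + 1
  | .tst, a, b => a = 0 ∧ b = 0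
  | .nop, a, b => b = a

/-- Regular programs over the elementary actions. -/
inductive Prog
  | op (k : Kind) (r : ℕ)
  | seq (P Q : Prog)
  | alt (P Q : Prog)
  | star (P : Prog)

/-- The input-output relation of a program on register contents. -/
def Prog.Rel : Prog → (ℕ → ℕ) → (ℕ → ℕ) → Prop
  | .op k r, s, s' => k.Rel (s r) (s' r) ∧ ∀ i, i ≠ r → s' i = s i
  | .seq P Q, s, s' => ∃ u, P.Rel s u ∧ Q.Rel u s'
  | .alt P Q, s, s' => P.Rel s s' ∨ Q.Rel s s'
  | .star P, s, s' => Relation.ReflTransGen P.Rel s s'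

namespace Prog

theorem rel_inc (r : ℕ) (s s' : ℕ → ℕ) :
    (op .inc r).Rel s s' ↔ s' = update s r (s r + 1) := by
  constructor
  · rintro ⟨h, h'⟩
    ext i
    by_cases hi : i = r
    · subst hi; simpa [Kind.Rel] using h
    · simp [hi, h' i hi]
  · rintro rfl
    exact ⟨by simp [Kind.Rel], fun i hi => by simp [hi]⟩

theorem rel_dec (r : ℕ) (s s' : ℕ → ℕ) :
    (op .dec r).Rel s s' ↔ 0 < s r ∧ s' = update s r (s r - 1) := by
  constructor
  · rintro ⟨h, h'⟩
    simp only [Kind.Rel] at h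
    refine ⟨by omega, ?_⟩
    ext i
    by_cases hi : i = r
    · subst hi; simp [h]
    · simp [hi, h' i hi]
  · rintro ⟨h, rfl⟩
    exact ⟨by simp only [Kind.Rel, update_self]; omega, fun i hi => by simp [hi]⟩

theorem rel_tst (r : ℕ) (s s' : ℕ → ℕ) :
    (op .tst r).Rel s s' ↔ s r = 0 ∧ s' = s := by
  constructor
  · rintro ⟨⟨h, h''⟩, h'⟩
    refine ⟨h, ?_⟩
    ext i
    by_cases hi : i = r
    · subst hi; simp [h, h'']
    · simp [h' i hi]
  · rintro ⟨h, rfl⟩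
    exact ⟨⟨h, h⟩, fun _ _ => rfl⟩

theorem rel_nop (r : ℕ) (s s' : ℕ → ℕ) : (op .nop r).Rel s s' ↔ s' = s := by
  constructor
  · rintro ⟨h, h'⟩
    ext i
    by_cases hi : i = r
    · subst hi; exact h
    · exact h' i hi
  · rintro rfl
    exact ⟨rfl, fun _ _ => rfl⟩

theorem rel_star_dec (r : ℕ) (s s' : ℕ → ℕ) :
    (star (op .dec r)).Rel s s' ↔ ∃ v ≤ s r, s' = update s r v := by
  constructor
  · intro h
    simp only [Rel] at h
    induction h with
    | refl => exact ⟨s r, le_rfl, by simp⟩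
    | tail _ h ih =>
      obtain ⟨v, hv, rfl⟩ := ih
      obtain ⟨h, rfl⟩ := (rel_dec _ _ _).1 h
      exact ⟨v - 1, by omega, by simp⟩
  · rintro ⟨v, hv, rfl⟩
    obtain ⟨k, hk⟩ := Nat.exists_eq_add_of_le hv
    induction k generalizing v with
    | zero => rw [show v = s r by omega, update_eq_self]; exact ReflTransGen.refl
    | succ k ih =>
      refine ReflTransGen.tail (ih (v + 1) (by omega) (by omega)) ((rel_dec _ _ _).2 ?_)
      simp

theorem rel_star_inc (r : ℕ) (s s' : ℕ → ℕ) :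
    (star (op .inc r)).Rel s s' ↔ ∃ v, s r ≤ v ∧ s' = update s r v := by
  constructor
  · intro h
    simp only [Rel] at h
    induction h with
    | refl => exact ⟨s r, le_rfl, by simp⟩
    | tail _ h ih =>
      obtain ⟨v, hv, rfl⟩ := ih
      exact ⟨v + 1, by omega, by simpa using (rel_inc _ _ _).1 h⟩
  · rintro ⟨v, hv, rfl⟩
    induction v, hv using Nat.le_induction with
    | base => rw [update_eq_self]; exact ReflTransGen.refl
    | succ v hv ih =>
      exact ReflTransGen.tail ih ((rel_inc _ _ _).2 (by simp))

/-- Assign zero to a register. -/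
def clear (r : ℕ) : Prog := seq (star (op .dec r)) (op .tst r)

/-- Assign an arbitrary value to a register. -/
def havoc (r : ℕ) : Prog := seq (star (op .dec r)) (star (op .inc r))

theorem rel_clear (r : ℕ) (s s' : ℕ → ℕ) : (clear r).Rel s s' ↔ s' = update s r 0 := by
  simp only [clear, Rel.eq_2, rel_star_dec, rel_tst]
  constructor
  · rintro ⟨u, ⟨v, -, rfl⟩, h, rfl⟩
    simp at h; simp [h]
  · rintro rfl
    exact ⟨_, ⟨0, by simp, rfl⟩, by simp, rfl⟩

theorem rel_havoc (r : ℕ) (s s' : ℕ → ℕ) :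
    (havoc r).Rel s s' ↔ ∃ v, s' = update s r v := by
  simp only [havoc, Rel.eq_2, rel_star_dec, rel_star_inc]
  constructor
  · rintro ⟨u, ⟨v, -, rfl⟩, w, -, rfl⟩
    exact ⟨w, by simp⟩
  · rintro ⟨v, rfl⟩
    exact ⟨_, ⟨0, by simp, rfl⟩, v, by simp, by simp⟩

/-- The program `P` tests the property `φ`, using as scratch space the registers from `B` on,
which must be zero initially. -/
def Tests (B : ℕ) (φ : (ℕ → ℕ) → Prop) (P : Prog) : Prop :=
  ∀ s, (∀ j, B ≤ j → s j = 0) → ∀ s', P.Rel s s' ↔ s' = s ∧ φ s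

/-- The body of the loops in `testEq`. -/
def shift (a b u : ℕ) : Prog := seq (op .dec a) (seq (op .dec b) (op .inc u))

/-- The inverse of `shift`. -/
def unshift (a b u : ℕ) : Prog := seq (op .dec u) (seq (op .inc b) (op .inc a))

/-- Compare the registers `a` and `b`, using `u` as scratch space. -/
def testEq (a b u : ℕ) : Prog :=
  seq (star (shift a b u)) (seq (op .tst a) (seq (op .tst b)
    (seq (star (unshift a b u)) (op .tst u))))

theorem rel_shift {a b u : ℕ} (hab : a ≠ b) (hau : a ≠ u) (hbu : b ≠ u) (s s' : ℕ → ℕ) :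
    (shift a b u).Rel s s' ↔ s a = s' a + 1 ∧ s b = s' b + 1 ∧ s' u = s u + 1 ∧
      ∀ i, i ≠ a → i ≠ b → i ≠ u → s' i = s i := by
  simp only [shift, Rel.eq_2, rel_dec, rel_inc]
  constructor
  · rintro ⟨_, ⟨h, rfl⟩, _, ⟨h', rfl⟩, rfl⟩
    rw [update_of_ne hab.symm] at h'
    refine ⟨?_, ?_, ?_, fun i h1 h2 h3 => ?_⟩
    · simp only [update_of_ne hau, update_of_ne hab, update_self]; omega
    · simp only [update_of_ne hbu, update_of_ne hab.symm, update_self]; omega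
    · simp only [update_of_ne hau.symm, update_of_ne hbu.symm, update_self]
    · simp [h1, h2, h3]
  · rintro ⟨h1, h2, h3, h4⟩
    refine ⟨_, ⟨by omega, rfl⟩, _, ⟨?_, rfl⟩, ?_⟩
    · rw [update_of_ne hab.symm]; omega
    · ext i
      simp only [update_apply]
      split_ifs <;> simp_all

theorem rel_unshift {a b u : ℕ} (hab : a ≠ b) (hau : a ≠ u) (hbu : b ≠ u) (s s' : ℕ → ℕ) :
    (unshift a b u).Rel s s' ↔ (shift a b u).Rel s' s := by
  rw [rel_shift hab hau hbu]
  simp only [unshift, Rel.eq_2, rel_dec, rel_inc]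
  constructor
  · rintro ⟨_, ⟨h, rfl⟩, _, rfl, rfl⟩
    refine ⟨?_, ?_, ?_, fun i h1 h2 h3 => ?_⟩
    · simp only [update_of_ne hau, update_of_ne hab, update_self]
    · simp only [update_of_ne hbu, update_of_ne hab.symm, update_self]
    · simp only [update_of_ne hau.symm, update_of_ne hbu.symm, update_self]; omega
    · simp [h1, h2, h3]
  · rintro ⟨h1, h2, h3, h4⟩
    refine ⟨_, ⟨by omega, rfl⟩, _, rfl, ?_⟩
    ext i
    simp only [update_apply]
    split_ifs <;> simp_all

theorem rel_star_shift {a b u : ℕ} (hab : a ≠ b) (hau : a ≠ u) (hbu : b ≠ u) (s s' : ℕ → ℕ) :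
    (star (shift a b u)).Rel s s' ↔ ∃ k, s a = s' a + k ∧ s b = s' b + k ∧ s' u = s u + k ∧
      ∀ i, i ≠ a → i ≠ b → i ≠ u → s' i = s i := by
  constructor
  · intro h
    simp only [Rel] at h
    induction h with
    | refl => exact ⟨0, by simp⟩
    | tail _ h ih =>
      obtain ⟨k, h1, h2, h3, h4⟩ := ih
      obtain ⟨g1, g2, g3, g4⟩ := (rel_shift hab hau hbu _ _).1 h
      refine ⟨k + 1, by omega, by omega, by omega, fun i i1 i2 i3 => ?_⟩
      rw [g4 i i1 i2 i3, h4 i i1 i2 i3]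
  · rintro ⟨k, h1, h2, h3, h4⟩
    induction k generalizing s' with
    | zero =>
      have : s' = s := by
        ext i
        by_cases i = a <;> by_cases i = b <;> by_cases i = u <;> simp_all
      subst this
      exact ReflTransGen.refl
    | succ k ih =>
      refine ReflTransGen.tail (ih (update (update (update s' a (s' a + 1)) b (s' b + 1)) u
        (s' u - 1)) ?_ ?_ ?_ fun i i1 i2 i3 => ?_) ((rel_shift hab hau hbu _ _).2 ⟨?_, ?_, ?_,
          fun i i1 i2 i3 => ?_⟩) <;> simp only [update_apply] <;> simp_all <;> omega

theorem rel_star_unshift {a b u : ℕ} (hab : a ≠ b) (hau : a ≠ u) (hbu : b ≠ u) (s s' : ℕ → ℕ) :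
    (star (unshift a b u)).Rel s s' ↔ (star (shift a b u)).Rel s' s := by
  have : (unshift a b u).Rel = swap (shift a b u).Rel := by
    ext s s'
    exact rel_unshift hab hau hbu s s'
  simp only [Rel]
  rw [this, reflTransGen_swap]

theorem tests_testEq {a b B : ℕ} (hab : a ≠ b) (ha : a < B) (hb : b < B) :
    Tests B (fun s => s a = s b) (testEq a b B) := by
  intro s hs s'
  simp only [testEq, Rel.eq_2, rel_tst, rel_star_unshift hab ha.ne hb.ne,
    rel_star_shift hab ha.ne hb.ne]
  have hB := hs B le_rfl
  constructor
  · rintro ⟨v, ⟨k, h1, h2, h3, h4⟩, _, ⟨ha0, rfl⟩, _, ⟨hb0, rfl⟩, w, ⟨l, g1, g2, g3, g4⟩, hu, rfl⟩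
    refine ⟨?_, by omega⟩
    ext i
    by_cases i1 : i = a
    · subst i1; omega
    by_cases i2 : i = b
    · subst i2; omega
    by_cases i3 : i = B
    · subst i3; omega
    rw [← g4 i i1 i2 i3, h4 i i1 i2 i3]
  · rintro ⟨rfl, h⟩
    refine ⟨update (update (update s' a 0) b 0) B (s' a), ⟨s' a, ?_⟩, _, ⟨?_, rfl⟩, _, ⟨?_, rfl⟩, s',
      ⟨s' a, ?_⟩, hB, rfl⟩
    all_goals simp only [update_apply]
    · simp [ha.ne, hb.ne, h, hB]
      intro i i1 i2 i3; simp [i1, i2, i3]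
    · simp [ha.ne]
    · simp [hb.ne]
    · simp [ha.ne, hb.ne, h, hB]
      intro i i1 i2 i3; simp [i1, i2, i3]

theorem exists_tests_eq (a b B : ℕ) (ha : a < B) (hb : b < B) :
    ∃ P, Tests B (fun s => s a = s b) P := by
  by_cases hab : a = b
  · subst hab
    exact ⟨op .nop 0, fun s _ s' => by simp [rel_nop]⟩
  · exact ⟨_, tests_testEq hab ha hb⟩

/-- A property of tuples of numbers is testable if, for every placement of the variables in
registers, some program tests it. -/
def Testable {ι : Type} (φ : (ι → ℕ) → Prop) : Prop :=
  ∀ (ρ : ι → ℕ) (B : ℕ), (∀ i, ρ i < B) → ∃ P, Tests B (fun s => φ fun i => s (ρ i)) P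

namespace Testable

variable {ι κ : Type}

theorem rename {φ : (ι → ℕ) → Prop} (h : Testable φ) (g : ι → κ) :
    Testable fun v : κ → ℕ => φ fun i => v (g i) :=
  fun ρ B hB => h (fun i => ρ (g i)) B fun _ => hB _

theorem and {φ ψ : (ι → ℕ) → Prop} (h : Testable φ) (h' : Testable ψ) :
    Testable fun v => φ v ∧ ψ v := by
  intro ρ B hB
  obtain ⟨P, hP⟩ := h ρ B hB
  obtain ⟨Q, hQ⟩ := h' ρ B hB
  refine ⟨seq P Q, fun s hs s' => ?_⟩
  simp only [Rel, hP s hs]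
  constructor
  · rintro ⟨_, ⟨rfl, h1⟩, h2⟩
    rw [hQ _ hs] at h2
    exact ⟨h2.1, h1, h2.2⟩
  · rintro ⟨rfl, h1, h2⟩
    exact ⟨_, ⟨rfl, h1⟩, (hQ _ hs _).2 ⟨rfl, h2⟩⟩

theorem true : Testable fun _ : ι → ℕ => True :=
  fun _ _ _ => ⟨op .nop 0, fun _ _ _ => by simp [rel_nop]⟩

theorem eq (a b : ι) : Testable fun v : ι → ℕ => v a = v b :=
  fun _ B hB => exists_tests_eq _ _ B (hB a) (hB b)

theorem eq_zero (a : ι) : Testable fun v : ι → ℕ => v a = 0 :=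
  fun ρ _ _ => ⟨op .tst (ρ a), fun s _ s' => by rw [rel_tst]; tauto⟩

theorem eq_succ (a b : ι) : Testable fun v : ι → ℕ => v b = v a + 1 := by
  intro ρ B hB
  by_cases hab : ρ a = ρ b
  · refine ⟨seq (op .inc 0) (op .tst 0), fun s _ s' => ?_⟩
    simp only [Rel.eq_2, rel_inc, rel_tst, hab]
    constructor
    · rintro ⟨_, rfl, h, -⟩
      simp at h
    · rintro ⟨_, h⟩
      omega
  · obtain ⟨P, hP⟩ := exists_tests_eq _ _ B (hB a) (hB b)
    refine ⟨seq (op .inc (ρ a)) (seq P (op .dec (ρ a))), fun s hs s' => ?_⟩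
    have hs' : ∀ j, B ≤ j → update s (ρ a) (s (ρ a) + 1) j = 0 := fun j hj => by
      rw [update_of_ne (by have := hB a; omega), hs j hj]
    simp only [Rel.eq_2, rel_inc, rel_dec]
    constructor
    · rintro ⟨_, rfl, _, h, -, rfl⟩
      rw [hP _ hs'] at h
      obtain ⟨rfl, h⟩ := h
      simp only [update_self, update_of_ne (Ne.symm hab)] at h
      simp [← h]
    · rintro ⟨rfl, h⟩
      refine ⟨_, rfl, _, (hP _ hs' _).2 ⟨rfl, ?_⟩, ?_, ?_⟩
      · simp only [update_self, update_of_ne (Ne.symm hab)]; omega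
      · simp
      · simp

theorem ex {φ : (Option ι → ℕ) → Prop} (h : Testable φ) :
    Testable fun v : ι → ℕ => ∃ x, φ fun i => i.elim x v := by
  intro ρ B hB
  obtain ⟨P, hP⟩ := h (fun i => i.elim B ρ) (B + 1) (by
    rintro (_ | i)
    · simp
    · exact (hB i).trans (Nat.lt_succ_self B))
  refine ⟨seq (havoc B) (seq P (clear B)), fun s hs s' => ?_⟩
  simp only [Rel.eq_2, rel_havoc, rel_clear]
  have hs' : ∀ x j, B + 1 ≤ j → update s B x j = 0 := fun x j hj => by
    rw [update_of_ne (by omega), hs j (by omega)]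
  have key : ∀ x, (fun i : Option ι => update s B x (i.elim B ρ)) =
      fun i => i.elim x fun i => s (ρ i) := by
    intro x
    ext (_ | i)
    · simp
    · simp [(hB i).ne]
  have hr : update s B 0 = s := by rw [← hs B le_rfl]; simp
  constructor
  · rintro ⟨_, ⟨x, rfl⟩, _, h, rfl⟩
    rw [hP _ (hs' x)] at h
    beta_reduce at h
    rw [key] at h
    obtain ⟨rfl, h⟩ := h
    exact ⟨by simpa using hr, x, h⟩
  · rintro ⟨rfl, x, h⟩
    refine ⟨_, ⟨x, rfl⟩, _, (hP _ (hs' x) _).2 ⟨rfl, ?_⟩, by simpa using hr.symm⟩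
    beta_reduce; rw [key]; exact h

theorem ex_fin {n : ℕ} {φ : (ι ⊕ Fin n → ℕ) → Prop} (h : Testable φ) :
    Testable fun v : ι → ℕ => ∃ z : Fin n → ℕ, φ (Sum.elim v z) := by
  induction n generalizing ι with
  | zero =>
    convert h.rename (Sum.elim id Fin.elim0 : ι ⊕ Fin 0 → ι) using 2 with v
    constructor
    · rintro ⟨z, hz⟩
      convert hz with i
      rcases i with i | i
      · rfl
      · exact i.elim0
    · intro hz
      refine ⟨Fin.elim0, ?_⟩
      convert hz with i
      rcases i with i | i
      · rfl
      · exact i.elim0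
  | succ n ih =>
    let g : ι ⊕ Fin (n + 1) → Option ι ⊕ Fin n :=
      Sum.elim (fun i => Sum.inl (some i)) (Fin.cases (Sum.inl none) Sum.inr)
    convert (ih (h.rename g)).ex using 2 with v
    have key : ∀ (x : ℕ) (z : Fin n → ℕ),
        (fun i => Sum.elim (fun i : Option ι => i.elim x v) z (g i)) =
          Sum.elim v (Fin.cons x z) := by
      intro x z
      ext (i | i)
      · rfl
      · refine Fin.cases ?_ (fun i => ?_) i <;> simp [g]
    simp only [key]
    constructor
    · rintro ⟨z, hz⟩
      exact ⟨z 0, Fin.tail z, by rwa [Fin.cons_self_tail]⟩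
    · rintro ⟨x, z, hz⟩
      exact ⟨_, hz⟩

theorem forall_fin {n : ℕ} {φ : Fin n → (ι → ℕ) → Prop} (h : ∀ i, Testable (φ i)) :
    Testable fun v => ∀ i, φ i v := by
  induction n with
  | zero => simpa using true
  | succ n ih =>
    simp only [Fin.forall_fin_succ]
    exact (h 0).and (ih fun i => h i.succ)

/-- One step of the iteration of `ψ`, on pairs of a step count and a value. -/
def IterStep (ψ : ℕ → ℕ → ℕ → Prop) (p q : ℕ × ℕ) : Prop := q.1 = p.1 + 1 ∧ ψ p.1 p.2 q.2

theorem iter {φ : (ι → ℕ) → ℕ → ℕ → ℕ → Prop}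
    (h : Testable fun v : ι ⊕ Fin 3 → ℕ =>
      φ (fun i => v (.inl i)) (v (.inr 0)) (v (.inr 1)) (v (.inr 2))) (n a b : ι) :
    Testable fun v : ι → ℕ => ReflTransGen (IterStep (φ v)) (0, v a) (v n, v b) := by
  intro ρ B hB
  obtain ⟨P, hP⟩ := h (Sum.elim ρ ![B, B + 1, B + 2]) (B + 3) (by
    rintro (i | i)
    · have := hB i; simp only [Sum.elim_inl]; omega
    · fin_cases i <;> simp)
  obtain ⟨Ea, hEa⟩ := exists_tests_eq (B + 1) (ρ a) (B + 3) (by omega) (by have := hB a; omega)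
  obtain ⟨Eb, hEb⟩ := exists_tests_eq (B + 1) (ρ b) (B + 3) (by omega) (by have := hB b; omega)
  obtain ⟨En, hEn⟩ := exists_tests_eq B (ρ n) (B + 3) (by omega) (by have := hB n; omega)
  obtain ⟨Ec, hEc⟩ := exists_tests_eq (B + 1) (B + 2) (B + 3) (by omega) (by omega)
  let body := seq (havoc (B + 2)) (seq P (seq (havoc (B + 1)) (seq Ec (seq (clear (B + 2))
    (op .inc B)))))
  refine ⟨seq (havoc (B + 1)) (seq Ea (seq (star body) (seq En (seq Eb (seq (clear B)
    (clear (B + 1))))))), fun s hs s' => ?_⟩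
  let S : ℕ → ℕ → ℕ → ℕ := fun i x => update (update s B i) (B + 1) x
  have hS : ∀ i x j, B + 2 ≤ j → S i x j = 0 := fun i x j hj => by
    simp only [S]
    rw [update_of_ne (by omega), update_of_ne (by omega), hs j (by omega)]
  have hS2 : ∀ i x, update (S i x) (B + 2) 0 = S i x := fun i x => by
    rw [← hS i x (B + 2) le_rfl]; simp
  have hSρ : ∀ i x k, S i x (ρ k) = s (ρ k) := fun i x k => by
    have := hB k
    simp only [S]
    rw [update_of_ne (by omega), update_of_ne (by omega)]
  have hSB : ∀ i x, S i x B = i := fun i x => by simp [S]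
  have hSB1 : ∀ i x, S i x (B + 1) = x := fun i x => by simp [S]
  have hup : ∀ i x y, update (S i x) (B + 1) y = S i y := fun i x y => by simp [S]
  have hup0 : ∀ i x j, update (S i x) B j = S j x := fun i x y => by
    simp only [S]
    rw [update_comm (by omega), update_idem]
  have hz : ∀ i x y j, B + 3 ≤ j → update (S i x) (B + 2) y j = 0 := fun i x y j hj => by
    rw [update_of_ne (by omega), hS _ _ _ (by omega)]
  have hz' : ∀ i x j, B + 3 ≤ j → S i x j = 0 := fun i x j hj => hS _ _ _ (by omega)
  have hbody : ∀ i x s', body.Rel (S i x) s' ↔ ∃ y, φ (fun k => s (ρ k)) i x y ∧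
      s' = S (i + 1) y := by
    intro i x s'
    simp only [body, Rel.eq_2, rel_havoc, rel_clear, rel_inc]
    have hφ : ∀ y, (fun s : ℕ → ℕ => φ (fun k => s (ρ k)) (s B) (s (B + 1)) (s (B + 2)))
        (update (S i x) (B + 2) y) ↔ φ (fun k => s (ρ k)) i x y := by
      intro y
      have : ∀ k, update (S i x) (B + 2) y (ρ k) = s (ρ k) := fun k => by
        rw [update_of_ne (by have := hB k; omega), hSρ]
      simp only [this, update_self]
      rw [update_of_ne (by omega), update_of_ne (by omega), hSB, hSB1]
    have hc : ∀ y z, update (update (S i x) (B + 2) y) (B + 1) z = update (S i z) (B + 2) y := by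
      intro y z
      rw [update_comm (by omega), hup]
    have hPs := fun y => hP (update (S i x) (B + 2) y) (hz i x y)
    simp only [Sum.elim_inl, Sum.elim_inr, Matrix.cons_val_zero, Matrix.cons_val_one,
      Matrix.cons_val] at hPs
    constructor
    · rintro ⟨_, ⟨y, rfl⟩, _, h1, _, ⟨z, rfl⟩, _, h2, _, rfl, rfl⟩
      rw [hPs] at h1
      obtain ⟨rfl, h1⟩ := h1
      rw [hc, hEc _ (hz i z y)] at h2
      obtain ⟨rfl, h2⟩ := h2
      rw [update_self, update_of_ne (by omega), hSB1] at h2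
      subst h2
      refine ⟨z, (hφ z).1 h1, ?_⟩
      rw [update_idem, hS2, hSB, hup0]
    · rintro ⟨y, h, rfl⟩
      refine ⟨_, ⟨y, rfl⟩, _, (hPs y _).2 ⟨rfl, (hφ y).2 h⟩, _, ⟨y, rfl⟩, _,
        (hEc _ (by rw [hc]; exact hz i y y) _).2 ⟨rfl, ?_⟩, _, rfl, ?_⟩
      · beta_reduce; rw [hc, update_self, update_of_ne (by omega), hSB1]
      · rw [hc, update_idem, hS2, hSB, hup0]
  have hstar : ∀ i x s', (star body).Rel (S i x) s' ↔
      ∃ q : ℕ × ℕ, ReflTransGen (IterStep (φ fun k => s (ρ k))) (i, x) q ∧ s' = S q.1 q.2 := by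
    intro i x s'
    constructor
    · intro h
      simp only [Rel] at h
      induction h with
      | refl => exact ⟨(i, x), .refl, rfl⟩
      | tail _ h ih =>
        obtain ⟨q, hq, rfl⟩ := ih
        obtain ⟨y, hy, rfl⟩ := (hbody _ _ _).1 h
        exact ⟨(q.1 + 1, y), hq.tail ⟨rfl, hy⟩, rfl⟩
    · rintro ⟨q, hq, rfl⟩
      induction hq with
      | refl => exact ReflTransGen.refl
      | @tail p q _ h ih =>
        refine ReflTransGen.tail ih ((hbody _ _ _).2 ⟨q.2, h.2, ?_⟩)
        rw [h.1]
  have hs0 : ∀ x, update s (B + 1) x = S 0 x := fun x => by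
    simp only [S]
    rw [← hs B le_rfl]; simp
  have hs00 : S 0 0 = s := by
    rw [← hs0, ← hs (B + 1) (by omega)]; simp
  simp only [Rel.eq_2, rel_havoc, rel_clear]
  constructor
  · rintro ⟨_, ⟨x, rfl⟩, _, h1, _, h2, _, h3, _, h4, _, rfl, rfl⟩
    rw [hs0, hEa _ (hz' _ _)] at h1
    beta_reduce at h1; rw [hSB1, hSρ] at h1
    obtain ⟨rfl, rfl⟩ := h1
    obtain ⟨q, hq, rfl⟩ := (hstar _ _ _).1 h2
    rw [hEn _ (hz' _ _)] at h3
    beta_reduce at h3; rw [hSB, hSρ] at h3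
    obtain ⟨rfl, h3⟩ := h3
    rw [hEb _ (hz' _ _)] at h4
    beta_reduce at h4; rw [hSB1, hSρ] at h4
    obtain ⟨rfl, h4⟩ := h4
    rw [hup0, hup, hs00, ← h3, ← h4]
    exact ⟨rfl, hq⟩
  · rintro ⟨rfl, hq⟩
    refine ⟨_, ⟨s' (ρ a), rfl⟩, _, (hEa _ (by rw [hs0]; exact hz' _ _) _).2 ⟨rfl, ?_⟩, S (s' (ρ n))
      (s' (ρ b)), ?_, _, (hEn _ (hz' _ _) _).2 ⟨rfl, ?_⟩, _, (hEb _ (hz' _ _) _).2 ⟨rfl, ?_⟩, _,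
      rfl, ?_⟩
    · beta_reduce; rw [hs0, hSB1, hSρ]
    · rw [hs0]
      exact (hstar _ _ _).2 ⟨_, hq, rfl⟩
    · beta_reduce; rw [hSB, hSρ]
    · beta_reduce; rw [hSB1, hSρ]
    · rw [hup0, hup, hs00]

/-- The graph of a primitive recursive function is testable. -/
theorem of_primrec' {n : ℕ} {f : List.Vector ℕ n → ℕ} (hf : Nat.Primrec' f) :
    Testable fun v : Option (Fin n) → ℕ =>
      f (List.Vector.ofFn fun i => v (some i)) = v none := by
  induction hf with
  | zero => simpa [eq_comm] using eq_zero (none : Option (Fin 0))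
  | succ =>
    convert eq_succ (some 0 : Option (Fin 1)) none using 2 with v
    beta_reduce; rw [← List.Vector.get_zero, List.Vector.get_ofFn, eq_comm]
  | get i => simpa using eq (some i) none
  | @comp n m f g _ _ ihf ihg =>
    have h1 : Testable fun v : Option (Fin n) ⊕ Fin m → ℕ =>
        ∀ j, g j (List.Vector.ofFn fun i => v (.inl (some i))) = v (.inr j) :=
      forall_fin fun j => (ihg j).rename
        (fun o : Option (Fin n) => o.elim (Sum.inr j) fun i => Sum.inl (some i))
    have h2 : Testable fun v : Option (Fin n) ⊕ Fin m → ℕ =>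
        f (List.Vector.ofFn fun i => v (.inr i)) = v (.inl none) :=
      ihf.rename (fun o : Option (Fin m) => o.elim (Sum.inl none) Sum.inr)
    convert (h1.and h2).ex_fin using 2 with v
    simp only [Sum.elim_inl, Sum.elim_inr]
    constructor
    · intro h
      exact ⟨_, fun j => rfl, h⟩
    · rintro ⟨z, hz, h⟩
      simpa [hz] using h
  | @prec n f g _ _ ihf ihg =>
    let ψ : (Option (Option (Fin (n + 1))) → ℕ) → ℕ → ℕ → ℕ → Prop := fun v i x y =>
      g (i ::ᵥ x ::ᵥ List.Vector.ofFn fun j : Fin n => v (some (some j.succ))) = y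
    have hψ : Testable fun v : Option (Option (Fin (n + 1))) ⊕ Fin 3 → ℕ =>
        ψ (fun i => v (.inl i)) (v (.inr 0)) (v (.inr 1)) (v (.inr 2)) := by
      have := ihg.rename (κ := Option (Option (Fin (n + 1))) ⊕ Fin 3)
        fun o : Option (Fin (n + 2)) => o.elim (Sum.inr 2)
          (Fin.cases (Sum.inr 0) (Fin.cases (Sum.inr 1) fun j => Sum.inl (some (some j.succ))))
      simpa only [ψ, List.Vector.ofFn, Option.elim_some, Option.elim_none, Fin.cases_zero,
        Fin.cases_succ] using this
    have h0 : Testable fun v : Option (Option (Fin (n + 1))) → ℕ =>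
        f (List.Vector.ofFn fun i => v (some (some i.succ))) = v none :=
      ihf.rename (fun o : Option (Fin n) => o.elim none fun j => some (some j.succ))
    convert (h0.and (iter hψ (some (some 0)) none (some none))).ex using 2 with v
    have hl : ∀ x (w : Option (Option (Fin (n + 1))) → ℕ) (q : ℕ × ℕ), ReflTransGen (IterStep (ψ w)) (0, x) q →
        q.2 = Nat.rec x (fun y IH => g (y ::ᵥ IH ::ᵥ List.Vector.ofFn fun j : Fin n =>
          w (some (some j.succ)))) q.1 := by
      intro x w q h
      induction h with
      | refl => rfl
      | tail _ h ih => rw [h.1, ← h.2, ih]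
    have hr : ∀ x (w : Option (Option (Fin (n + 1))) → ℕ) k, ReflTransGen (IterStep (ψ w)) (0, x) (k,
        Nat.rec x (fun y IH => g (y ::ᵥ IH ::ᵥ List.Vector.ofFn fun j : Fin n =>
          w (some (some j.succ)))) k) := by
      intro x w k
      induction k with
      | zero => exact .refl
      | succ k ih => exact .tail ih ⟨rfl, rfl⟩
    simp only [List.Vector.ofFn, List.Vector.head_cons, List.Vector.tail_cons, Option.elim_some,
      Option.elim_none]
    constructor
    · intro h
      refine ⟨_, rfl, ?_⟩
      rw [← h]
      exact hr _ (fun i => i.elim _ v) _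
    · rintro ⟨x, rfl, h⟩
      exact (hl _ (fun i => i.elim _ v) _ h).symm

end Testable

end Prog

/-! ### Compiling programs to counter machines -/

/-- A nondeterministic machine with `m + 1` counters. From the idle state, entered at will from the
initial state, and from the halting state, it may decrement counters and waste time. -/
structure Machine (m : ℕ) (σ : Type) where
  Edge : σ → Kind → Fin (m + 1) → σ → Prop
  start : σ
  idle : σ
  halt : σ
  start_idle : Edge start .nop 0 idle
  idle_dec : ∀ j, Edge idle .dec j idle
  idle_nop : Edge idle .nop 0 idle
  halt_dec : ∀ j, Edge halt .dec j halt
  halt_nop : Edge halt .nop 0 halt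

/-- The step relation of a machine on its configurations. -/
def Machine.Step {m : ℕ} {σ : Type} (M : Machine m σ) (p q : σ × (Fin (m + 1) → ℕ)) : Prop :=
  ∃ k j, M.Edge p.1 k j q.1 ∧ k.Rel (p.2 j) (q.2 j) ∧ ∀ i, i ≠ j → q.2 i = p.2 i

/-- The configurations reachable with input `n` in counter `0`. -/
def Machine.Reach {m : ℕ} {σ : Type} (M : Machine m σ) (n : ℕ) (p : σ) (c : Fin (m + 1) → ℕ) :
    Prop :=
  ReflTransGen M.Step (M.start, Pi.single 0 n) (p, c)

namespace Prog

/-- The input-output relation of a list of programs run one after the other. -/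
def RelList : List Prog → (ℕ → ℕ) → (ℕ → ℕ) → Prop
  | [], s, s' => s' = s
  | P :: K, s, t => ∃ u, P.Rel s u ∧ RelList K u t

/-- The transitions of the machine executing a list of programs. -/
inductive Edge : List Prog → Kind → ℕ → List Prog → Prop
  | op (k r K) : Edge (.op k r :: K) k r K
  | seq (P Q K) : Edge (.seq P Q :: K) .nop 0 (P :: Q :: K)
  | altl (P Q K) : Edge (.alt P Q :: K) .nop 0 (P :: K)
  | altr (P Q K) : Edge (.alt P Q :: K) .nop 0 (Q :: K)
  | leave (P K) : Edge (.star P :: K) .nop 0 K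
  | loop (P K) : Edge (.star P :: K) .nop 0 (P :: .star P :: K)

/-- The lists of programs that occur while executing `P` with continuation `K`. -/
def closure : Prog → List Prog → Set (List Prog)
  | .op k r, K => {.op k r :: K}
  | .seq P Q, K => insert (.seq P Q :: K) (closure P (Q :: K) ∪ closure Q K)
  | .alt P Q, K => insert (.alt P Q :: K) (closure P K ∪ closure Q K)
  | .star P, K => insert (.star P :: K) (closure P (.star P :: K))

theorem finite_closure (P : Prog) (K : List Prog) : (closure P K).Finite := by
  induction P generalizing K with
  | op => exact Set.finite_singleton _
  | seq P Q hP hQ => exact ((hP _).union (hQ _)).insert _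
  | alt P Q hP hQ => exact ((hP _).union (hQ _)).insert _
  | star P hP => exact (hP _).insert _

theorem cons_mem_closure (P : Prog) (K : List Prog) : P :: K ∈ closure P K := by
  cases P <;> simp [closure]

theorem mem_closure_of_edge {P : Prog} {K L L' : List Prog} {k : Kind} {r : ℕ}
    (hL : L ∈ closure P K) (h : Edge L k r L') : L' ∈ closure P K ∨ L' = K := by
  induction P generalizing K with
  | op =>
    obtain rfl : L = _ := hL
    cases h
    exact .inr rfl
  | seq P Q hP hQ =>
    rcases hL with rfl | hL | hL
    · cases h
      exact .inl (.inr (.inl (cons_mem_closure _ _)))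
    · rcases hP hL with h | rfl
      · exact .inl (.inr (.inl h))
      · exact .inl (.inr (.inr (cons_mem_closure _ _)))
    · rcases hQ hL with h | rfl
      · exact .inl (.inr (.inr h))
      · exact .inr rfl
  | alt P Q hP hQ =>
    rcases hL with rfl | hL | hL
    · cases h
      · exact .inl (.inr (.inl (cons_mem_closure _ _)))
      · exact .inl (.inr (.inr (cons_mem_closure _ _)))
    · rcases hP hL with h | rfl
      · exact .inl (.inr (.inl h))
      · exact .inr rfl
    · rcases hQ hL with h | rfl
      · exact .inl (.inr (.inr h))
      · exact .inr rfl
  | star P hP =>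
    rcases hL with rfl | hL
    · cases h
      · exact .inr rfl
      · exact .inl (.inr (cons_mem_closure _ _))
    · rcases hP hL with h | rfl
      · exact .inl (.inr h)
      · exact .inl (.inl rfl)

/-- An upper bound for the registers of a program. -/
def bound : Prog → ℕ
  | .op _ r => r
  | .seq P Q => max P.bound Q.bound
  | .alt P Q => max P.bound Q.bound
  | .star P => P.bound

/-- The step relation of the machine executing lists of programs, with `m + 1` counters. -/
def Step (m : ℕ) (p q : List Prog × (Fin (m + 1) → ℕ)) : Prop :=
  ∃ (k : Kind) (j : Fin (m + 1)), Edge p.1 k j q.1 ∧ k.Rel (p.2 j) (q.2 j) ∧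
    ∀ i, i ≠ j → q.2 i = p.2 i

theorem step_nop {m : ℕ} {L L' : List Prog} (h : Edge L .nop 0 L') (c : Fin (m + 1) → ℕ) :
    Step m (L, c) (L', c) :=
  ⟨.nop, 0, h, rfl, fun _ _ => rfl⟩

theorem reach_of_rel {m : ℕ} {P : Prog} (hP : P.bound ≤ m) {s s' : ℕ → ℕ} (h : P.Rel s s')
    (K : List Prog) :
    ReflTransGen (Step m) (P :: K, fun j => s j) (K, fun j => s' j) := by
  induction P generalizing s s' K with
  | op k r =>
    refine .single ⟨k, ⟨r, Nat.lt_succ_of_le hP⟩, .op _ _ _, h.1, fun i hi => h.2 _ ?_⟩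
    rintro rfl
    exact hi rfl
  | seq P Q ihP ihQ =>
    obtain ⟨u, h1, h2⟩ := h
    exact (ReflTransGen.single (step_nop (.seq P Q K) _)).trans
      ((ihP ((le_max_left _ _).trans hP) h1 _).trans (ihQ ((le_max_right _ _).trans hP) h2 _))
  | alt P Q ihP ihQ =>
    rcases h with h | h
    · exact (ReflTransGen.single (step_nop (.altl P Q K) _)).trans
        (ihP ((le_max_left _ _).trans hP) h _)
    · exact (ReflTransGen.single (step_nop (.altr P Q K) _)).trans
        (ihQ ((le_max_right _ _).trans hP) h _)
  | star P ih =>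
    simp only [Rel] at h
    refine ReflTransGen.trans ?_ (.single (step_nop (.leave P K) _))
    induction h with
    | refl => exact .refl
    | tail _ h ih' =>
      exact ih'.trans ((ReflTransGen.single (step_nop (.loop P K) _)).trans (ih hP h _))

theorem relList_of_edge {m : ℕ} {L L' : List Prog} {k : Kind} {j : Fin (m + 1)} {s : ℕ → ℕ}
    {c : Fin (m + 1) → ℕ} (h : Edge L k j L') (hk : k.Rel (s j) (c j))
    (hc : ∀ i, i ≠ j → c i = s i)
    (hL' : ∀ s : ℕ → ℕ, (∀ j : Fin (m + 1), s j = c j) → ∃ s', RelList L' s s') :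
    ∃ s', RelList L s s' := by
  have hnop : k = .nop → ∃ s', RelList L' s s' := by
    rintro rfl
    refine hL' s fun i => ?_
    by_cases hi : i = j
    · subst hi; exact hk.symm
    · exact (hc i hi).symm
  generalize hr : (j : ℕ) = r at h
  cases h with
  | op k r K =>
    subst hr
    obtain ⟨s', hs'⟩ := hL' (update s j (c j)) fun i => by
      by_cases hi : i = j
      · subst hi; simp
      · rw [update_of_ne (fun h => hi (Fin.ext h)), hc i hi]
    exact ⟨s', _, ⟨by simpa using hk, fun i hi => by simp [hi]⟩, hs'⟩
  | seq P Q K =>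
    obtain ⟨s', u, h1, v, h2, h3⟩ := hnop rfl
    exact ⟨s', v, ⟨u, h1, h2⟩, h3⟩
  | altl P Q K =>
    obtain ⟨s', u, h1, h2⟩ := hnop rfl
    exact ⟨s', u, .inl h1, h2⟩
  | altr P Q K =>
    obtain ⟨s', u, h1, h2⟩ := hnop rfl
    exact ⟨s', u, .inr h1, h2⟩
  | leave P K =>
    obtain ⟨s', h⟩ := hnop rfl
    exact ⟨s', s, .refl, h⟩
  | loop P K =>
    obtain ⟨s', u, h1, v, h2, h3⟩ := hnop rfl
    exact ⟨s', v, ReflTransGen.head h1 h2, h3⟩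

/-- The non-idle states of the machine of a program. -/
abbrev State (P : Prog) : Type := {L : List Prog // L ∈ insert [] (closure P [])}

/-- The transitions of the machine of a program; the idle state is `none`. -/
def MachineEdge (P : Prog) :
    Option P.State → Kind → Fin (P.bound + 1) → Option P.State → Prop
  | some L, k, j, some L' =>
    Edge L.1 k j L'.1 ∨ (L.1 = [] ∧ L'.1 = [] ∧ (k = .dec ∨ k = .nop))
  | some L, k, _, none => L.1 = [P] ∧ k = .nop
  | none, k, _, none => k = .dec ∨ k = .nop
  | none, _, _, some _ => False

/-- The machine executing a program. -/
def machine (P : Prog) : Machine P.bound (Option P.State) where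
  Edge := P.MachineEdge
  start := some ⟨[P], .inr (cons_mem_closure P [])⟩
  idle := none
  halt := some ⟨[], .inl rfl⟩
  start_idle := ⟨rfl, rfl⟩
  idle_dec _ := .inl rfl
  idle_nop := .inr rfl
  halt_dec _ := .inr ⟨rfl, rfl, .inl rfl⟩
  halt_nop := .inr ⟨rfl, rfl, .inr rfl⟩

instance (P : Prog) : Finite P.State :=
  Set.Finite.to_subtype ((finite_closure P []).insert [])

theorem machine_halts_iff (P : Prog) (n : ℕ) :
    (∃ c, P.machine.Reach n P.machine.halt c) ↔ ∃ s', P.Rel (Pi.single 0 n) s' := by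
  constructor
  · rintro ⟨c, h⟩
    let Good (p : Option P.State × (Fin (P.bound + 1) → ℕ)) : Prop := ∃ L, p.1 = some L ∧
      ∀ s : ℕ → ℕ, (∀ j : Fin (P.bound + 1), s j = p.2 j) → ∃ s', RelList L.1 s s'
    have key : Good (P.machine.start, Pi.single 0 n) := by
      refine ReflTransGen.head_induction_on (motive := fun p _ => Good p) h
        ⟨_, rfl, fun s _ => ⟨s, rfl⟩⟩ ?_
      rintro ⟨p, c⟩ ⟨q, d⟩ ⟨k, j, h, hk, hj⟩ - ⟨L', hq, hL'⟩
      obtain rfl : q = some L' := hq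
      rcases p with _ | L
      · exact h.elim
      refine ⟨L, rfl, fun s hs => ?_⟩
      rcases h with h | ⟨h, -⟩
      · refine relList_of_edge (c := d) h ?_ (fun i hi => ?_) hL'
        · rw [hs]; exact hk
        · rw [hs]; exact hj i hi
      · exact ⟨s, by rw [h]; rfl⟩
    obtain ⟨L, hL, h⟩ := key
    obtain rfl := Option.some_injective _ hL
    obtain ⟨s', u, hu, -⟩ := h (Pi.single 0 n) fun j => by
      simp only [Pi.single_apply, Fin.ext_iff, Fin.val_zero]
    exact ⟨u, hu⟩
  · rintro ⟨s', h⟩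
    refine ⟨fun j => s' j, ?_⟩
    have hr := reach_of_rel le_rfl h []
    have key : ∀ q, ReflTransGen (Step P.bound)
        ([P], fun j : Fin (P.bound + 1) => (Pi.single 0 n : ℕ → ℕ) j) q →
        ∃ hq, P.machine.Reach n (some ⟨q.1, hq⟩) q.2 := by
      intro q hq
      induction hq with
      | refl =>
        refine ⟨.inr (cons_mem_closure P []), ?_⟩
        have : (fun j : Fin (P.bound + 1) => (Pi.single 0 n : ℕ → ℕ) j) = Pi.single 0 n := by
          ext j
          simp only [Pi.single_apply, Fin.ext_iff, Fin.val_zero]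
        rw [this]
        exact .refl
      | @tail p q _ h ih =>
        obtain ⟨hp, ih⟩ := ih
        obtain ⟨k, j, h, h'⟩ := h
        have hq : q.1 ∈ insert [] (closure P []) := by
          rcases hp with hp | hp
          · rw [hp] at h; cases h
          · exact (mem_closure_of_edge hp h).symm
        exact ⟨hq, ReflTransGen.tail ih ⟨k, j, .inl h, h'⟩⟩
    exact (key _ hr).2

end Prog

/-! ### Vector addition systems with finitely many locations -/

/-- A vector addition system with locations `Q`, components `C` and transitions `T`. -/
structure Net (C Q T : Type) where
  src : T → Q
  tgt : T → Q
  eff : T → C → ℤ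

namespace Net

variable {C Q T : Type}

/-- The configurations reachable using the transitions in `A`. The Boolean is the parity of the
number of transitions used. -/
inductive Reach (V : Net C Q T) (A : Set T) (q₀ : Q) (x₀ : C → ℕ) : Q → Bool → (C → ℕ) → Prop
  | base : Reach V A q₀ x₀ q₀ false x₀
  | step {t : T} {b : Bool} {x x' : C → ℕ} : t ∈ A → Reach V A q₀ x₀ (V.src t) b x →
      (∀ c, (x' c : ℤ) = x c + V.eff t c) → Reach V A q₀ x₀ (V.tgt t) (!b) x'

theorem Reach.mono {V : Net C Q T} {A B : Set T} (h : A ⊆ B) {q₀ : Q} {x₀ : C → ℕ} {q : Q}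
    {b : Bool} {x : C → ℕ} (hx : V.Reach A q₀ x₀ q b x) : V.Reach B q₀ x₀ q b x := by
  induction hx with
  | base => exact .base
  | step ht _ he ih => exact .step (h ht) ih he

open Classical in
/-- The configuration vector of a location, a parity and the contents of the components. -/
noncomputable def cfg (q : Q) (b : Bool) (x : C → ℕ) : C ⊕ Q × Bool → ℕ :=
  Sum.elim x fun p => if p = (q, b) then 1 else 0

open Classical in
/-- The displacement simulating a transition at a given parity. -/
noncomputable def act (V : Net C Q T) (t : T) (b : Bool) : C ⊕ Q × Bool → ℤ :=
  Sum.elim (V.eff t) fun p =>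
    (if p = (V.tgt t, !b) then 1 else 0) - (if p = (V.src t, b) then 1 else 0)

theorem cfg_step (V : Net C Q T) {t : T} {q : Q} {b b' : Bool} {x : C → ℕ} {z : C ⊕ Q × Bool → ℕ}
    (h : ∀ i, (z i : ℤ) = cfg q b' x i + V.act t b i) :
    (q, b') = (V.src t, b) ∧ z = cfg (V.tgt t) (!b) fun c => z (.inl c) := by
  have h1 := h (.inr (V.src t, b))
  have hne : (V.src t, b) ≠ (V.tgt t, !b) := by simp
  have hq : (q, b') = (V.src t, b) := by
    by_contra hq
    simp only [cfg, act, Sum.elim_inr, if_neg hne, if_neg (Ne.symm hq)] at h1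
    simp at h1
  refine ⟨hq, funext ?_⟩
  have hq' := Prod.mk.inj hq
  rintro (c | p)
  · rfl
  · have h2 := h (.inr p)
    rw [hq'.1, hq'.2] at h2
    simp only [cfg, act, Sum.elim_inr] at h2 ⊢
    split_ifs at h2 ⊢ with h3 h4 h4
    · exact absurd (h4.symm.trans h3) hne
    all_goals simp at h2; omega

theorem act_cfg (V : Net C Q T) {t : T} {b : Bool} {x x' : C → ℕ}
    (h : ∀ c, (x' c : ℤ) = x c + V.eff t c) (i : C ⊕ Q × Bool) :
    (cfg (V.tgt t) (!b) x' i : ℤ) = cfg (V.src t) b x i + V.act t b i := by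
  rcases i with c | p
  · exact h c
  · simp only [cfg, act, Sum.elim_inr]
    split_ifs <;> simp

section Rep

variable {I : Type} {d : ℕ}

/-- Extension by zero of a vector whose index set is identified with the first `d` numbers. -/
def ext {R : Type} [Zero R] (e : I ≃ Fin d) (z : I → R) (k : ℕ) : R :=
  if h : k < d then z (e.symm ⟨k, h⟩) else 0

theorem ext_apply {R : Type} [Zero R] (e : I ≃ Fin d) (z : I → R) (i : I) :
    ext e z (e i) = z i := by
  simp [ext]

theorem ext_of_le {R : Type} [Zero R] (e : I ≃ Fin d) (z : I → R) {k : ℕ} (h : d ≤ k) :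
    ext e z k = 0 := by
  simp [ext, h]

theorem forall_ext (e : I ≃ Fin d) {P : ℕ → Prop} :
    (∀ k, P k) ↔ (∀ i, P (e i)) ∧ ∀ k, d ≤ k → P k := by
  refine ⟨fun h => ⟨fun i => h _, fun k _ => h k⟩, fun h k => ?_⟩
  by_cases hk : k < d
  · simpa using h.1 (e.symm ⟨k, hk⟩)
  · exact h.2 k (by omega)

theorem getD_ofFn_ext {R : Type} [Zero R] (e : I ≃ Fin d) (z : I → R) (k : ℕ) :
    (if k < d then (List.ofFn fun k => z (e.symm k)).getD k 0 else 0) = ext e z k := by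
  by_cases h : k < d <;> simp [ext, h]

theorem getD_map {α β : Type} (f : α → β) {l : List α} {a : ℕ} (h : a < l.length) (y : β) :
    (l.map f).getD a y = f l[a] := by
  simp [h]

end Rep

section

variable [Finite T] {d : ℕ}

open Classical in
/-- The representation of a vector addition system with locations as one without locations. -/
noncomputable def rep (V : Net C Q T) (A : Set T) (q₀ : Q) (e : C ⊕ Q × Bool ≃ Fin d)
    (x₀ : C → ℕ) : VRep :=
  (d, (Set.toFinite (A ×ˢ (Set.univ : Set Bool))).toFinset.toList.map
      fun p => List.ofFn fun k => V.act p.1 p.2 (e.symm k),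
    List.ofFn fun k => cfg q₀ false x₀ (e.symm k))

variable (V : Net C Q T) (A : Set T) (q₀ : Q) (e : C ⊕ Q × Bool ≃ Fin d) (x₀ : C → ℕ)

theorem rep_step (x y : ℕ → ℕ) : (V.rep A q₀ e x₀).Step x y ↔
    ∃ t ∈ A, ∃ b, ∀ k, (y k : ℤ) = x k + ext e (V.act t b) k := by
  have hr (a k : ℕ) (l : List (List ℤ)) (x : List ℕ) : VRep.rule (d, l, x) a k =
      if k < d then (l.getD a []).getD k 0 else 0 := rfl
  constructor
  · rintro ⟨a, ha, h⟩
    simp only [rep, List.length_map] at ha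
    have hm := List.getElem_mem ha
    simp only [Finset.mem_toList, Set.Finite.mem_toFinset, Set.mem_prod, Set.mem_univ,
      and_true] at hm
    refine ⟨_, hm, (Set.toFinite (A ×ˢ (Set.univ : Set Bool))).toFinset.toList[a].2,
      fun k => (h k).trans ?_⟩
    rw [rep, hr, getD_map _ ha, getD_ofFn_ext]
  · rintro ⟨t, ht, b, h⟩
    have hm : (t, b) ∈ (Set.toFinite (A ×ˢ (Set.univ : Set Bool))).toFinset.toList := by
      simpa using ht
    obtain ⟨a, ha, hab⟩ := List.getElem_of_mem hm
    refine ⟨a, by simpa [rep] using ha, fun k => (h k).trans ?_⟩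
    rw [rep, hr, getD_map _ ha, getD_ofFn_ext, hab]

theorem mem_rep_reach (y : ℕ → ℕ) : y ∈ (V.rep A q₀ e x₀).Reach ↔
    ∃ q b x, V.Reach A q₀ x₀ q b x ∧ y = ext e (cfg q b x) := by
  have h0 : (V.rep A q₀ e x₀).initSt = ext e (cfg q₀ false x₀) :=
    funext fun k => getD_ofFn_ext e _ k
  constructor
  · intro h
    induction h with
    | refl => exact ⟨q₀, false, x₀, .base, h0⟩
    | tail _ hs ih =>
      rename_i y z _
      obtain ⟨q, b', x, hx, rfl⟩ := ih
      obtain ⟨t, ht, b, hz⟩ := (rep_step ..).1 hs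
      rw [forall_ext e] at hz
      simp only [ext_apply] at hz
      obtain ⟨hq, hz'⟩ := V.cfg_step (z := fun i => z (e i)) hz.1
      obtain ⟨rfl, rfl⟩ := Prod.mk.inj hq
      refine ⟨_, _, _, .step ht hx fun c => hz.1 (.inl c), funext ?_⟩
      rw [forall_ext e]
      refine ⟨fun i => ?_, fun k hk => ?_⟩
      · rw [ext_apply, ← hz']
      · have := hz.2 k hk
        simp only [ext_of_le e _ hk] at this ⊢
        exact_mod_cast this
  · rintro ⟨q, b, x, hx, rfl⟩
    induction hx with
    | base => exact h0 ▸ ReflTransGen.refl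
    | @step t b x x' ht _ he ih =>
      refine ReflTransGen.tail ih ((rep_step ..).2 ⟨t, ht, b, ?_⟩)
      rw [forall_ext e]
      refine ⟨fun i => ?_, fun k hk => ?_⟩
      · simpa only [ext_apply] using V.act_cfg he i
      · simp [ext_of_le e _ hk]

theorem cfg_le_cfg {q q' : Q} {b b' : Bool} {x x' : C → ℕ} :
    (∀ i, cfg q b x i ≤ cfg q' b' x' i) ↔ q = q' ∧ b = b' ∧ ∀ c, x c ≤ x' c := by
  constructor
  · intro h
    have h1 := h (.inr (q, b))
    simp only [cfg, Sum.elim_inr, if_pos] at h1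
    split_ifs at h1 with h2
    · obtain ⟨rfl, rfl⟩ := Prod.mk.inj h2
      exact ⟨rfl, rfl, fun c => h (.inl c)⟩
    · omega
  · rintro ⟨rfl, rfl, h⟩ (c | p)
    · exact h c
    · exact le_rfl

/-- Inclusion of refined covers in terms of the systems with locations. -/
theorem rep_cover_subset {zero : C} (he : (e (.inl zero) : ℕ) = 0) (B : Set T) :
    (V.rep A q₀ e x₀).Cover1 ⊆ (V.rep B q₀ e x₀).Cover1 ↔
      ∀ q b x, V.Reach A q₀ x₀ q b x →
        ∃ x', V.Reach B q₀ x₀ q b x' ∧ x zero = x' zero ∧ ∀ c, x c ≤ x' c := by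
  have h0 (q b) (x : C → ℕ) : ext e (cfg q b x) 0 = x zero := by
    rw [← he, ext_apply]; rfl
  constructor
  · intro h q b x hx
    obtain ⟨y, hy, hy0, hle⟩ := h ⟨_, (mem_rep_reach ..).2 ⟨q, b, x, hx, rfl⟩, rfl, fun _ => le_rfl⟩
    obtain ⟨q', b', x', hx', rfl⟩ := (mem_rep_reach ..).1 hy
    rw [forall_ext e] at hle
    simp only [ext_apply] at hle
    obtain ⟨rfl, rfl, hxx'⟩ := cfg_le_cfg.1 hle.1
    exact ⟨x', hx', by simpa only [h0] using hy0, hxx'⟩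
  · rintro h z ⟨y, hy, hz0, hz⟩
    obtain ⟨q, b, x, hx, rfl⟩ := (mem_rep_reach ..).1 hy
    obtain ⟨x', hx', hx0, hle⟩ := h q b x hx
    refine ⟨_, (mem_rep_reach ..).2 ⟨q, b, x', hx', rfl⟩, ?_, fun i => (hz i).trans ?_⟩
    · simpa only [h0, hx0] using hz0
    · revert i
      rw [forall_ext e]
      simp only [ext_apply]
      exact ⟨cfg_le_cfg.2 ⟨rfl, rfl, hle⟩, fun k hk => by simp [ext_of_le e _ hk]⟩

end

end Net

/-! ### Simulating a counter machine in the refined cover -/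

/-- The components of the simulating system. -/
inductive Comp (m : ℕ)
  | tot | out | bud
  | cnt (j : Fin (m + 1)) | rem (j : Fin (m + 1)) | rem' (j : Fin (m + 1))
  | don (j : Fin (m + 1)) | don' (j : Fin (m + 1))
  deriving DecidableEq

/-- The locations of the simulating system. -/
inductive Loc (m : ℕ) (σ : Type)
  | gen | fin
  | loc (p : σ)
  | gain (k : Kind) (j : Fin (m + 1)) (q : σ)
  | back (j : Fin (m + 1)) (q : σ)

/-- The transitions of the simulating system. -/
inductive Trans (m : ℕ) (σ : Type)
  | grow | start | give | accept | pump
  | op (p : σ) (k : Kind) (j : Fin (m + 1)) (q : σ)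
  | gainR (k : Kind) (j : Fin (m + 1)) (q : σ)
  | gainD (k : Kind) (j : Fin (m + 1)) (q : σ)
  | turn (k : Kind) (j : Fin (m + 1)) (q : σ)
  | backR (j : Fin (m + 1)) (q : σ)
  | backD (j : Fin (m + 1)) (q : σ)
  | done (j : Fin (m + 1)) (q : σ)

instance (m : ℕ) : Finite (Comp m) := by
  refine Finite.of_injective
    (β := Fin 8 × Option (Fin (m + 1)))
    (fun
      | .tot => (0, none)
      | .out => (1, none)
      | .bud => (2, none)
      | .cnt j => (3, some j)
      | .rem j => (4, some j)
      | .rem' j => (5, some j)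
      | .don j => (6, some j)
      | .don' j => (7, some j)) ?_
  rintro (_ | _) (_ | _) h <;> simp_all

instance (m : ℕ) (σ : Type) [Finite σ] : Finite (Loc m σ) := by
  refine Finite.of_injective
    (β := Fin 5 × Option Kind × Option (Fin (m + 1)) × Option σ)
    (fun
      | .gen => (0, none, none, none)
      | .fin => (1, none, none, none)
      | .loc p => (2, none, none, some p)
      | .gain k j q => (3, some k, some j, some q)
      | .back j q => (4, none, some j, some q)) ?_
  rintro (_ | _) (_ | _) h <;> simp_all

instance (m : ℕ) (σ : Type) [Finite σ] : Finite (Trans m σ) := by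
  refine Finite.of_injective
    (β := Fin 12 × Option σ × Option Kind × Option (Fin (m + 1)) × Option σ)
    (fun
      | .grow => (0, none, none, none, none)
      | .start => (1, none, none, none, none)
      | .give => (2, none, none, none, none)
      | .accept => (3, none, none, none, none)
      | .pump => (4, none, none, none, none)
      | .op p k j q => (5, some p, some k, some j, some q)
      | .gainR k j q => (6, none, some k, some j, some q)
      | .gainD k j q => (7, none, some k, some j, some q)
      | .turn k j q => (8, none, some k, some j, some q)
      | .backR j q => (9, none, none, some j, some q)
      | .backD j q => (10, none, none, some j, some q)
      | .done j q => (11, none, none, some j, some q)) ?_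
  rintro (_ | _) (_ | _) h <;> simp_all

/-- The reward for moving one unit of `rem` after an operation. -/
def Kind.reward : Kind → ℕ
  | .inc => 0
  | .dec => 2
  | .tst => 1
  | .nop => 1

/-- The displacement of a transition of the simulating system. -/
def Trans.eff {m : ℕ} {σ : Type} : Trans m σ → Comp m → ℤ
  | .grow => fun
    | .tot => 1
    | .bud => 1
    | .rem _ => 1
    | _ => 0
  | .start => 0
  | .give => Pi.single .out (-1)
  | .accept => 0
  | .pump => fun
    | .tot => 0
    | .out => 0
    | _ => 1
  | .op _ k j _ => Pi.single .bud (-1) +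
    match k with
    | .inc => Pi.single (.cnt j) 1
    | .dec => Pi.single (.cnt j) (-1)
    | .tst => Pi.single (.rem j) (-1) + Pi.single (.don j) 1
    | .nop => 0
  | .gainR k j _ =>
    Pi.single (.rem j) (-1) + Pi.single (.rem' j) 1 + Pi.single .out (k.reward : ℤ)
  | .gainD _ j _ => Pi.single (.don j) (-1) + Pi.single (.don' j) 1 + Pi.single .out 1
  | .turn _ _ _ => 0
  | .backR j _ => Pi.single (.rem' j) (-1) + Pi.single (.rem j) 1
  | .backD j _ => Pi.single (.don' j) (-1) + Pi.single (.don j) 1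
  | .done _ _ => 0

namespace Machine

variable {m : ℕ} {σ : Type} (M : Machine m σ)

/-- The system simulating a counter machine. -/
def net : Net (Comp m) (Loc m σ) (Trans m σ) where
  src
    | .grow => .gen
    | .start => .gen
    | .give => .loc M.idle
    | .accept => .loc M.halt
    | .pump => .fin
    | .op p _ _ _ => .loc p
    | .gainR k j q => .gain k j q
    | .gainD k j q => .gain k j q
    | .turn k j q => .gain k j q
    | .backR j q => .back j q
    | .backD j q => .back j q
    | .done j q => .back j q
  tgt
    | .grow => .gen
    | .start => .loc M.start
    | .give => .fin
    | .accept => .fin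
    | .pump => .fin
    | .op _ k j q => .gain k j q
    | .gainR k j q => .gain k j q
    | .gainD k j q => .gain k j q
    | .turn _ j q => .back j q
    | .backR j q => .back j q
    | .backD j q => .back j q
    | .done _ q => .loc q
  eff := Trans.eff

/-- The transitions of the simulating system, where `acc` tells whether accepting is allowed. -/
def trans (acc : Prop) : Set (Trans m σ) :=
  {t | match t with
    | .op p k j q => M.Edge p k j q
    | .accept => acc
    | _ => True}

/-- The initial contents of the components for input `n`. -/
def input (m n : ℕ) : Comp m → ℕ
  | .bud => n
  | .cnt j => if j = 0 then n else 0
  | _ => 0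

/-- Reachability in the simulating system. -/
abbrev NetReach (acc : Prop) (n : ℕ) : Loc m σ → Bool → (Comp m → ℕ) → Prop :=
  M.net.Reach (M.trans acc) .gen (input m n)

/-! #### Soundness -/

/-- The largest value of the output permitted by the invariant. -/
def bound (n : ℕ) (x : Comp m → ℕ) : ℕ := x .tot * (x .tot + 2 * n)

/-- The potential of a configuration outside of an operation. -/
def potential (x : Comp m → ℕ) : ℕ :=
  x .out + ∑ j, x (.cnt j) * (x (.rem j) + x (.rem' j)) + x .tot * x .bud

/-- The balance condition of the simulation. -/
def Balanced (x : Comp m → ℕ) : Prop :=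
  ∀ j, x (.rem j) + x (.rem' j) + x (.don j) + x (.don' j) = x .tot

/-- The invariant of the simulation at each location. -/
def Inv (acc : Prop) (n : ℕ) (x : Comp m → ℕ) : Loc m σ → Prop
  | .gen => x .out = 0 ∧ x .bud = x .tot + n ∧ (∀ j, x (.cnt j) = (Pi.single 0 n : _ → ℕ) j) ∧
      ∀ j, x (.rem j) = x .tot ∧ x (.rem' j) = 0 ∧ x (.don j) = 0 ∧ x (.don' j) = 0
  | .fin => x .out ≤ bound n x ∧ (x .out = bound n x → acc ∧ ∃ c, M.Reach n M.halt c)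
  | .loc p => Balanced x ∧ potential x ≤ bound n x ∧
      (potential x = bound n x → M.Reach n p fun j => x (.cnt j))
  | .gain k j q => Balanced x ∧ potential x + k.reward * x (.rem j) + x (.don j) ≤ bound n x ∧
      (potential x + k.reward * x (.rem j) + x (.don j) = bound n x →
        M.Reach n q fun j => x (.cnt j))
  | .back _ q => Balanced x ∧ potential x ≤ bound n x ∧
      (potential x = bound n x → M.Reach n q fun j => x (.cnt j))

theorem sum_add_eq_sum_add {ι : Type} [Fintype ι] {f g : ι → ℕ} (j : ι)
    (h : ∀ i, i ≠ j → f i = g i) : ∑ i, f i + g j = ∑ i, g i + f j := by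
  classical
  rw [← Finset.add_sum_erase _ _ (Finset.mem_univ j), ← Finset.add_sum_erase _ g (Finset.mem_univ j),
    Finset.sum_congr rfl fun i hi => h i (Finset.ne_of_mem_erase hi)]
  ring

theorem potential_add {x x' : Comp m → ℕ} (j : Fin (m + 1))
    (h : ∀ i, i ≠ j → x' (.cnt i) = x (.cnt i) ∧ x' (.rem i) + x' (.rem' i) =
      x (.rem i) + x (.rem' i)) (ht : x' .tot = x .tot) :
    potential x' + x .out + x (.cnt j) * (x (.rem j) + x (.rem' j)) + x .tot * x .bud =
      potential x + x' .out + x' (.cnt j) * (x' (.rem j) + x' (.rem' j)) + x .tot * x' .bud := by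
  have := sum_add_eq_sum_add (f := fun j => x' (.cnt j) * (x' (.rem j) + x' (.rem' j)))
    (g := fun j => x (.cnt j) * (x (.rem j) + x (.rem' j))) j
    fun i hi => by simp only [(h i hi).1, (h i hi).2]
  simp only [potential, ht]
  omega

theorem inv_op {acc : Prop} {n : ℕ} {p q : σ} {k : Kind} {j : Fin (m + 1)} {x x' : Comp m → ℕ}
    (hE : M.Edge p k j q) (h : M.Inv acc n x (.loc p))
    (he : ∀ c, (x' c : ℤ) = x c + Trans.eff (.op p k j q) c) :
    M.Inv acc n x' (.gain k j q) := by
  obtain ⟨hb, hp, hr⟩ := h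
  have htot : x' .tot = x .tot := by
    have := he .tot
    cases k <;> simpa [Trans.eff] using this
  have hout : x' .out = x .out := by
    have := he .out
    cases k <;> simpa [Trans.eff] using this
  have hbud : x .bud = x' .bud + 1 := by
    have := he .bud
    cases k <;> simp [Trans.eff] at this <;> omega
  have hcnt (i) (hi : i ≠ j) : x' (.cnt i) = x (.cnt i) := by
    have := he (.cnt i)
    cases k <;> simpa [Trans.eff, hi] using this
  have hrem (i) (hi : i ≠ j) : x' (.rem i) = x (.rem i) := by
    have := he (.rem i)
    cases k <;> simpa [Trans.eff, hi] using this
  have hdon (i) (hi : i ≠ j) : x' (.don i) = x (.don i) := by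
    have := he (.don i)
    cases k <;> simpa [Trans.eff, hi] using this
  have hrem' (i) : x' (.rem' i) = x (.rem' i) := by
    have := he (.rem' i)
    cases k <;> simpa [Trans.eff] using this
  have hdon' (i) : x' (.don' i) = x (.don' i) := by
    have := he (.don' i)
    cases k <;> simpa [Trans.eff] using this
  have hpot := potential_add (x := x) (x' := x') j
    (fun i hi => ⟨hcnt i hi, by rw [hrem i hi, hrem' i]⟩) htot
  have hstep (hrel : k.Rel (x (.cnt j)) (x' (.cnt j))) (heq : potential x = bound n x) :
      M.Reach n q fun j => x' (.cnt j) :=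
    ReflTransGen.tail (hr heq) ⟨k, j, hE, hrel, hcnt⟩
  have hbound : bound n x' = bound n x := by simp only [bound, htot]
  have hcj := he (.cnt j)
  have hrj := he (.rem j)
  have hdj := he (.don j)
  have hbj := hb j
  have hb' (h : x' (.rem j) + x' (.don j) = x (.rem j) + x (.don j)) : Balanced x' := by
    intro i
    by_cases hi : i = j
    · subst hi
      rw [htot, hrem', hdon']
      omega
    · rw [htot, hrem', hdon', hrem i hi, hdon i hi, hb i]
  simp only [Inv, hbound]
  rw [hout, hbud, hrem'] at hpot
  cases k
  · replace hcj : x' (.cnt j) = x (.cnt j) + 1 := by simp [Trans.eff] at hcj; omega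
    replace hrj : x' (.rem j) = x (.rem j) := by simp [Trans.eff] at hrj; omega
    replace hdj : x' (.don j) = x (.don j) := by simp [Trans.eff] at hdj; omega
    simp only [hcj, hrj, hdj, Kind.reward, add_mul, mul_add, one_mul, mul_one] at hpot ⊢
    exact ⟨hb' (by omega), by omega, fun h => hstep hcj (by omega)⟩
  · replace hcj : x (.cnt j) = x' (.cnt j) + 1 := by simp [Trans.eff] at hcj; omega
    replace hrj : x' (.rem j) = x (.rem j) := by simp [Trans.eff] at hrj; omega
    replace hdj : x' (.don j) = x (.don j) := by simp [Trans.eff] at hdj; omega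
    simp only [hcj, hrj, hdj, Kind.reward, add_mul, mul_add, one_mul, mul_one] at hpot ⊢
    exact ⟨hb' (by omega), by omega, fun h => hstep hcj (by omega)⟩
  · replace hcj : x' (.cnt j) = x (.cnt j) := by simp [Trans.eff] at hcj; omega
    replace hrj : x (.rem j) = x' (.rem j) + 1 := by simp [Trans.eff] at hrj; omega
    replace hdj : x' (.don j) = x (.don j) + 1 := by simp [Trans.eff] at hdj; omega
    simp only [hcj, hrj, hdj, Kind.reward, mul_add, one_mul, mul_one] at hpot ⊢
    exact ⟨hb' (by omega), by omega, fun h => hstep ⟨by omega, by omega⟩ (by omega)⟩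
  · replace hcj : x' (.cnt j) = x (.cnt j) := by simp [Trans.eff] at hcj; omega
    replace hrj : x' (.rem j) = x (.rem j) := by simp [Trans.eff] at hrj; omega
    replace hdj : x' (.don j) = x (.don j) := by simp [Trans.eff] at hdj; omega
    simp only [hcj, hrj, hdj, Kind.reward, mul_add, one_mul, mul_one] at hpot ⊢
    exact ⟨hb' (by omega), by omega, fun h => hstep hcj (by omega)⟩

theorem inv_gainR {acc : Prop} {n : ℕ} {q : σ} {k : Kind} {j : Fin (m + 1)} {x x' : Comp m → ℕ}
    (h : M.Inv acc n x (.gain k j q))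
    (he : ∀ c, (x' c : ℤ) = x c + Trans.eff (.gainR k j q) c) :
    M.Inv acc n x' (.gain k j q) := by
  obtain ⟨hb, hp, hr⟩ := h
  have htot : x' .tot = x .tot := by simpa [Trans.eff] using he .tot
  have hout : x' .out = x .out + k.reward := by
    have := he .out
    simp [Trans.eff] at this
    omega
  have hbud : x' .bud = x .bud := by simpa [Trans.eff] using he .bud
  have hcnt (i) : x' (.cnt i) = x (.cnt i) := by simpa [Trans.eff] using he (.cnt i)
  have hdon (i) : x' (.don i) = x (.don i) := by simpa [Trans.eff] using he (.don i)
  have hdon' (i) : x' (.don' i) = x (.don' i) := by simpa [Trans.eff] using he (.don' i)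
  have hsum (i) : x' (.rem i) + x' (.rem' i) = x (.rem i) + x (.rem' i) := by
    have h1 := he (.rem i)
    have h2 := he (.rem' i)
    by_cases hi : i = j
    · subst hi
      simp [Trans.eff] at h1 h2
      omega
    · simp [Trans.eff, hi] at h1 h2
      omega
  have hrj : x (.rem j) = x' (.rem j) + 1 := by
    have := he (.rem j)
    simp [Trans.eff] at this
    omega
  have hpot : potential x' = potential x + k.reward := by
    simp only [potential, htot, hout, hbud, hcnt, hsum]
    omega
  have hbound : bound n x' = bound n x := by simp only [bound, htot]
  refine ⟨fun i => ?_, ?_⟩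
  · rw [hsum, hdon, hdon', htot, hb i]
  · rw [hrj, mul_add, mul_one] at hp hr
    rw [hpot, hbound, hdon]
    simp only [hcnt]
    exact ⟨by omega, fun h => hr (by omega)⟩

theorem inv_gainD {acc : Prop} {n : ℕ} {q : σ} {k : Kind} {j : Fin (m + 1)} {x x' : Comp m → ℕ}
    (h : M.Inv acc n x (.gain k j q))
    (he : ∀ c, (x' c : ℤ) = x c + Trans.eff (.gainD k j q) c) :
    M.Inv acc n x' (.gain k j q) := by
  obtain ⟨hb, hp, hr⟩ := h
  have htot : x' .tot = x .tot := by simpa [Trans.eff] using he .tot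
  have hout : x' .out = x .out + 1 := by
    have := he .out
    simp [Trans.eff] at this
    omega
  have hbud : x' .bud = x .bud := by simpa [Trans.eff] using he .bud
  have hcnt (i) : x' (.cnt i) = x (.cnt i) := by simpa [Trans.eff] using he (.cnt i)
  have hrem (i) : x' (.rem i) = x (.rem i) := by simpa [Trans.eff] using he (.rem i)
  have hrem' (i) : x' (.rem' i) = x (.rem' i) := by simpa [Trans.eff] using he (.rem' i)
  have hdj : x (.don j) = x' (.don j) + 1 := by
    have := he (.don j)
    simp [Trans.eff] at this
    omega
  have hpot : potential x' = potential x + 1 := by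
    simp only [potential, htot, hout, hbud, hcnt, hrem, hrem']
    omega
  have hbound : bound n x' = bound n x := by simp only [bound, htot]
  refine ⟨fun i => ?_, ?_⟩
  · have h1 := he (.don i)
    have h2 := he (.don' i)
    have := hb i
    rw [hrem, hrem', htot]
    by_cases hi : i = j
    · subst hi
      simp [Trans.eff] at h1 h2
      omega
    · simp [Trans.eff, hi] at h1 h2
      omega
  · rw [hpot, hbound, hrem]
    simp only [hcnt]
    exact ⟨by omega, fun h => hr (by omega)⟩

theorem inv_back {acc : Prop} {n : ℕ} {q : σ} {j : Fin (m + 1)} {x x' : Comp m → ℕ}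
    (h : M.Inv acc n x (.back j q))
    (he : (∀ c, (x' c : ℤ) = x c + Trans.eff (.backR j q) c) ∨
      ∀ c, (x' c : ℤ) = x c + Trans.eff (.backD j q) c) :
    M.Inv acc n x' (.back j q) := by
  obtain ⟨hb, hp, hr⟩ := h
  have htot : x' .tot = x .tot := by
    rcases he with he | he <;> simpa [Trans.eff] using he .tot
  have hout : x' .out = x .out := by
    rcases he with he | he <;> simpa [Trans.eff] using he .out
  have hbud : x' .bud = x .bud := by
    rcases he with he | he <;> simpa [Trans.eff] using he .bud
  have hcnt (i) : x' (.cnt i) = x (.cnt i) := by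
    rcases he with he | he <;> simpa [Trans.eff] using he (.cnt i)
  have hsum (i) : x' (.rem i) + x' (.rem' i) = x (.rem i) + x (.rem' i) ∧
      x' (.don i) + x' (.don' i) = x (.don i) + x (.don' i) := by
    rcases he with he | he <;>
    · have h1 := he (.rem i)
      have h2 := he (.rem' i)
      have h3 := he (.don i)
      have h4 := he (.don' i)
      by_cases hi : i = j
      · subst hi
        simp [Trans.eff] at h1 h2 h3 h4
        omega
      · simp [Trans.eff, hi] at h1 h2 h3 h4
        omega
  have hpot : potential x' = potential x := by
    simp only [potential, htot, hout, hbud, hcnt, hsum]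
  have hbound : bound n x' = bound n x := by simp only [bound, htot]
  refine ⟨fun i => ?_, ?_⟩
  · have := hsum i
    have := hb i
    rw [htot]
    omega
  · rw [hpot, hbound]
    simpa only [hcnt] using ⟨hp, hr⟩

theorem inv_start {acc : Prop} {n : ℕ} {x : Comp m → ℕ} (h : M.Inv acc n x .gen) :
    M.Inv acc n x (.loc M.start) := by
  obtain ⟨h1, h2, h3, h4⟩ := h
  have hpot : potential x = bound n x := by
    simp only [potential, bound, h1, h2, h3, fun j => (h4 j).1, fun j => (h4 j).2.1]
    rw [← Finset.sum_mul, Finset.sum_pi_single']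
    simp
    ring
  refine ⟨fun j => ?_, hpot.le, fun _ => ?_⟩
  · have := h4 j
    omega
  · rw [show (fun j => x (.cnt j)) = Pi.single 0 n from funext h3]
    exact .refl

theorem out_le_potential (x : Comp m → ℕ) : x .out ≤ potential x := by
  simp only [potential]
  omega

/-- Reachable configurations satisfy the invariant. -/
theorem NetReach.inv {acc : Prop} {n : ℕ} {l : Loc m σ} {b : Bool} {x : Comp m → ℕ}
    (h : M.NetReach acc n l b x) : M.Inv acc n x l := by
  induction h with
  | base => simp [Inv, input, Pi.single_apply]
  | @step t b x x' ht _ he ih =>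
    have heq (h0 : t.eff = 0) : x' = x := by
      funext c
      simpa [net, h0] using he c
    cases t with
    | grow =>
      obtain ⟨h1, h2, h3, h4⟩ := ih
      have htot := he .tot
      have hout := he .out
      have hbud := he .bud
      simp [net, Trans.eff] at htot hout hbud
      refine ⟨by omega, by omega, fun j => ?_, fun j => ?_⟩
      · simpa [net, Trans.eff, h3] using he (.cnt j)
      · have := h4 j
        have h5 := he (.rem j)
        have h6 := he (.rem' j)
        have h7 := he (.don j)
        have h8 := he (.don' j)
        simp [net, Trans.eff] at h5 h6 h7 h8
        omega
    | start => exact heq rfl ▸ M.inv_start ih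
    | give =>
      obtain ⟨-, h1, -⟩ := ih
      have h2 := out_le_potential x
      have htot : x' .tot = x .tot := by simpa [net, Trans.eff] using he .tot
      have hbound : bound n x' = bound n x := by simp only [bound, htot]
      have hout := he .out
      simp [net, Trans.eff] at hout
      exact ⟨by omega, fun h => by omega⟩
    | accept =>
      obtain rfl := heq rfl
      obtain ⟨-, h1, h2⟩ := ih
      have h3 := out_le_potential x'
      exact ⟨h3.trans h1, fun h => ⟨ht, _, h2 (by omega)⟩⟩
    | pump =>
      have htot : x' .tot = x .tot := by simpa [net, Trans.eff] using he .tot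
      have hout : x' .out = x .out := by simpa [net, Trans.eff] using he .out
      change M.Inv acc n x' .fin
      have : M.Inv acc n x .fin := ih
      simpa only [Inv, bound, htot, hout] using this
    | op p k j q => exact M.inv_op ht ih he
    | gainR k j q => exact M.inv_gainR ih he
    | gainD k j q => exact M.inv_gainD ih he
    | turn k j q =>
      obtain rfl := heq rfl
      obtain ⟨hb, h1, h2⟩ := ih
      exact ⟨hb, by omega, fun h => h2 (by omega)⟩
    | backR j q => exact M.inv_back ih (.inl he)
    | backD j q => exact M.inv_back ih (.inr he)
    | done j q => exact heq rfl ▸ ih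

end Machine

/-! #### Completeness -/

theorem Net.Reach.loop {C Q T : Type} {V : Net C Q T} {A : Set T} {q₀ : Q} {x₀ : C → ℕ} {t : T}
    (ht : t ∈ A) (h : V.tgt t = V.src t) (s : ℕ) {b : Bool} {x : C → ℕ}
    (hx : V.Reach A q₀ x₀ (V.src t) b x) (hs : ∀ c, 0 ≤ x c + s * V.eff t c) :
    ∃ b' x', V.Reach A q₀ x₀ (V.src t) b' x' ∧ ∀ c, (x' c : ℤ) = x c + s * V.eff t c := by
  induction s with
  | zero => exact ⟨b, x, hx, by simp⟩
  | succ s ih =>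
    have hs' (c) : 0 ≤ (x c : ℤ) + s * V.eff t c := by
      have := hs c
      push_cast at this
      rcases le_total 0 (V.eff t c) with h0 | h0
      · positivity
      · linarith
    obtain ⟨b', x', hx', he⟩ := ih hs'
    refine ⟨!b', fun c => (x' c + V.eff t c).toNat, ?_, fun c => ?_⟩
    · rw [← h]
      refine .step ht hx' fun c => Int.toNat_of_nonneg ?_
      have := hs c
      push_cast at this
      rw [he]
      linarith
    · have := hs c
      push_cast at this ⊢
      rw [Int.toNat_of_nonneg] <;> rw [he] <;> linarith

namespace Machine

variable {m : ℕ} {σ : Type} (M : Machine m σ) (acc : Prop) (n : ℕ)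

/-- Reachability in the simulating system at any parity. -/
def AnyReach (l : Loc m σ) (x : Comp m → ℕ) : Prop := ∃ b, M.NetReach acc n l b x

variable {M acc n}

theorem AnyReach.step {t : Trans m σ} {x : Comp m → ℕ} (ht : t ∈ M.trans acc)
    (hx : M.AnyReach acc n (M.net.src t) x) (hs : ∀ c, 0 ≤ (x c : ℤ) + t.eff c) :
    ∃ x', M.AnyReach acc n (M.net.tgt t) x' ∧ ∀ c, (x' c : ℤ) = x c + t.eff c := by
  obtain ⟨b, hx⟩ := hx
  exact ⟨fun c => (x c + t.eff c).toNat,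
    ⟨_, .step ht hx fun c => Int.toNat_of_nonneg (hs c)⟩, fun c => Int.toNat_of_nonneg (hs c)⟩

theorem AnyReach.loop {t : Trans m σ} {x : Comp m → ℕ} (ht : t ∈ M.trans acc)
    (h : M.net.tgt t = M.net.src t) (s : ℕ)
    (hx : M.AnyReach acc n (M.net.src t) x) (hs : ∀ c, 0 ≤ x c + s * t.eff c) :
    ∃ x', M.AnyReach acc n (M.net.src t) x' ∧ ∀ c, (x' c : ℤ) = x c + s * t.eff c := by
  obtain ⟨b, hx⟩ := hx
  obtain ⟨b', x', hx', he⟩ := Net.Reach.loop ht h s hx hs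
  exact ⟨x', ⟨b', hx'⟩, he⟩

/-- Moving everything forth and back after an operation collects the full reward. -/
theorem AnyReach.round {k : Kind} {j : Fin (m + 1)} {q : σ} {x : Comp m → ℕ}
    (hx : M.AnyReach acc n (.gain k j q) x) :
    ∃ x', M.AnyReach acc n (.loc q) x' ∧
      x' .out = x .out + k.reward * x (.rem j) + x (.don j) ∧ ∀ c, c ≠ .out → x' c = x c := by
  obtain ⟨x₁, h₁, e₁⟩ := AnyReach.loop (t := .gainR k j q) trivial rfl (x (.rem j)) hx (by
    rintro (_ | _ | _ | i | i | i | i | i) <;> simp [Trans.eff, Pi.single_apply] <;>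
      (try split_ifs with hi) <;> (try subst hi) <;> (try simp) <;> positivity)
  obtain ⟨x₂, h₂, e₂⟩ := AnyReach.loop (t := .gainD k j q) trivial rfl (x (.don j)) h₁ (by
    have := e₁ (.don j)
    simp [Trans.eff] at this
    rintro (_ | _ | _ | i | i | i | i | i) <;> simp [Trans.eff, Pi.single_apply] <;>
      (try split_ifs with hi) <;> (try subst hi) <;> (try simp [this]) <;> positivity)
  obtain ⟨x₃, h₃, e₃⟩ := AnyReach.step (t := .turn k j q) trivial h₂ (by simp [Trans.eff])
  have e (c) : (x₃ c : ℤ) = x c + x (.rem j) * Trans.eff (.gainR k j q) c +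
      x (.don j) * Trans.eff (.gainD k j q) c := by
    rw [e₃, e₂, e₁]
    simp [Trans.eff]
  obtain ⟨x₄, h₄, e₄⟩ := AnyReach.loop (t := .backR j q) trivial rfl (x (.rem j)) h₃ (by
    have := e (.rem' j)
    simp [Trans.eff] at this
    rintro (_ | _ | _ | i | i | i | i | i) <;> simp [Trans.eff, Pi.single_apply] <;>
      (try split_ifs with hi) <;> (try subst hi) <;> (try simp [this]) <;> positivity)
  obtain ⟨x₅, h₅, e₅⟩ := AnyReach.loop (t := .backD j q) trivial rfl (x (.don j)) h₄ (by
    have h1 := e₄ (.don' j)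
    have h2 := e (.don' j)
    simp [Trans.eff] at h1 h2
    rintro (_ | _ | _ | i | i | i | i | i) <;> simp [Trans.eff, Pi.single_apply] <;>
      (try split_ifs with hi) <;> (try subst hi) <;> (try simp [h1, h2]) <;> positivity)
  obtain ⟨x₆, h₆, e₆⟩ := AnyReach.step (t := .done j q) trivial h₅ (by simp [Trans.eff])
  have e' (c) : (x₆ c : ℤ) = x c + (x (.rem j) * k.reward + x (.don j)) *
      (Pi.single Comp.out 1 : _ → ℤ) c := by
    rw [e₆, e₅, e₄, e]
    simp only [Trans.eff, Pi.add_apply, Pi.zero_apply]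
    have hs (a : Comp m) (z : ℤ) : (Pi.single a z : _ → ℤ) c = z * (Pi.single a 1 : _ → ℤ) c := by
      simp [Pi.single_apply]
    rw [hs (.rem j) (-1), hs (.rem' j) (-1), hs (.don j) (-1), hs (.don' j) (-1), hs .out k.reward]
    ring
  refine ⟨x₆, h₆, ?_, fun c hc => by simpa [hc] using e' c⟩
  have := e' .out
  simp at this
  zify
  linarith

variable (M acc n)

/-- The configurations reachable by a simulation in which no output has been lost. -/
def Perfect (N b w : ℕ) (p : σ) (c : Fin (m + 1) → ℕ) : Prop :=
  ∃ x, M.AnyReach acc n (.loc p) x ∧ x .tot = N ∧ x .bud = b ∧ (∀ j, x (.cnt j) = c j) ∧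
    (∀ j, w ≤ x (.rem j) ∧ x (.rem' j) = 0 ∧ x (.don' j) = 0) ∧ Balanced x ∧
    potential x = bound n x

theorem perfect_start (N : ℕ) : M.Perfect acc n N (N + n) N M.start (Pi.single 0 n) := by
  obtain ⟨x₁, h₁, e₁⟩ := AnyReach.loop (M := M) (acc := acc) (n := n) (t := .grow) trivial rfl N
    ⟨false, .base⟩ (by
      rintro (_ | _ | _ | i | i | i | i | i) <;> simp [Trans.eff] <;> positivity)
  obtain ⟨x₂, h₂, e₂⟩ := AnyReach.step (t := .start) trivial h₁ (by simp [Trans.eff])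
  have e (c) : (x₂ c : ℤ) = input m n c + N * Trans.eff (σ := σ) .grow c := by
    rw [e₂, e₁]
    simp [Trans.eff]
  have h1 : x₂ .tot = N := by simpa [Trans.eff, input] using e .tot
  have h2 : x₂ .out = 0 := by simpa [Trans.eff, input] using e .out
  have h3 : x₂ .bud = N + n := by
    have := e .bud
    simp [Trans.eff, input] at this
    omega
  have h4 (j) : x₂ (.cnt j) = (Pi.single 0 n : _ → ℕ) j := by
    have := e (.cnt j)
    simp only [Trans.eff, input, mul_zero, add_zero, Nat.cast_inj] at this
    rw [this, Pi.single_apply]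
  have h5 (j) : x₂ (.rem j) = N := by simpa [Trans.eff, input] using e (.rem j)
  have h6 (j) : x₂ (.rem' j) = 0 := by simpa [Trans.eff, input] using e (.rem' j)
  have h7 (j) : x₂ (.don j) = 0 := by simpa [Trans.eff, input] using e (.don j)
  have h8 (j) : x₂ (.don' j) = 0 := by simpa [Trans.eff, input] using e (.don' j)
  refine ⟨x₂, h₂, h1, h3, h4, fun j => ⟨(h5 j).ge, h6 j, h8 j⟩, fun j => ?_, ?_⟩
  · simp only [h1, h5, h6, h7, h8, add_zero]
  · simp only [potential, bound, h1, h2, h3, h4, h5, h6]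
    rw [← Finset.sum_mul, Finset.sum_pi_single']
    simp
    ring

variable {M acc n}

theorem Perfect.step {N b w w' : ℕ} {p q : σ} {k : Kind} {j : Fin (m + 1)}
    {c c' : Fin (m + 1) → ℕ} (h : M.Perfect acc n N (b + 1) w p c) (hE : M.Edge p k j q)
    (hrel : k.Rel (c j) (c' j)) (hc : ∀ i, i ≠ j → c' i = c i) (hw : w' ≤ w)
    (hk : k = .tst → w' < w) : M.Perfect acc n N b w' q c' := by
  obtain ⟨x, hx, hN, hb, hcx, hwx, hbal, hpot⟩ := h
  have hcj := hcx j
  have hwj := (hwx j).1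
  obtain ⟨x₁, h₁, e₁⟩ := AnyReach.step (t := .op p k j q) hE hx (by
    rintro (_ | _ | _ | i | i | i | i | i) <;> cases k <;>
      simp [Trans.eff, Pi.single_apply, hb, Kind.Rel] at hk hrel ⊢ <;>
      (try split_ifs with hi) <;> (try subst hi) <;> omega)
  obtain ⟨x₂, h₂, hout, e₂⟩ := AnyReach.round h₁
  have htot : x₂ .tot = x .tot := by
    have := e₁ .tot
    rw [e₂ _ (by simp)]
    cases k <;> simpa [Trans.eff] using this
  have hout₁ : x₁ .out = x .out := by
    have := e₁ .out
    cases k <;> simpa [Trans.eff] using this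
  have hbud : x₂ .bud = b := by
    have := e₁ .bud
    rw [e₂ _ (by simp)]
    cases k <;> simp [Trans.eff, hb] at this <;> omega
  have hcnt (i) (hi : i ≠ j) : x₂ (.cnt i) = x (.cnt i) := by
    have := e₁ (.cnt i)
    rw [e₂ _ (by simp)]
    cases k <;> simpa [Trans.eff, hi] using this
  have hrem (i) (hi : i ≠ j) : x₂ (.rem i) = x (.rem i) := by
    have := e₁ (.rem i)
    rw [e₂ _ (by simp)]
    cases k <;> simpa [Trans.eff, hi] using this
  have hdon (i) (hi : i ≠ j) : x₂ (.don i) = x (.don i) := by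
    have := e₁ (.don i)
    rw [e₂ _ (by simp)]
    cases k <;> simpa [Trans.eff, hi] using this
  have hrem' (i) : x₂ (.rem' i) = 0 := by
    have := e₁ (.rem' i)
    rw [e₂ _ (by simp)]
    cases k <;> simpa [Trans.eff, hwx i] using this
  have hdon' (i) : x₂ (.don' i) = 0 := by
    have := e₁ (.don' i)
    rw [e₂ _ (by simp)]
    cases k <;> simpa [Trans.eff, hwx i] using this
  have hcj₂ : x₂ (.cnt j) = c' j := by
    have := e₁ (.cnt j)
    rw [e₂ _ (by simp)]
    cases k <;> simp [Trans.eff, Kind.Rel] at this hrel <;> omega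
  have hrj := e₁ (.rem j)
  have hdj := e₁ (.don j)
  rw [← e₂ _ (by simp)] at hrj hdj
  have hadd := potential_add (x := x) (x' := x₂) j
    (fun i hi => ⟨hcnt i hi, by rw [hrem i hi, hrem' i, (hwx i).2.1]⟩) htot
  have hbj := hbal j
  have hwj' := hwx j
  have hbound : bound n x₂ = bound n x := by simp only [bound, htot]
  rw [← e₂ (.rem j) (by simp), ← e₂ (.don j) (by simp), hout₁] at hout
  rw [hout, hbud, hb, hcj₂, hcx, hrem', hwj'.2.1] at hadd
  have key : w' ≤ x₂ (.rem j) ∧ x₂ (.rem j) + x₂ (.don j) = x (.rem j) + x (.don j) ∧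
      potential x₂ = potential x := by
    cases k
    · replace hrj : x₂ (.rem j) = x (.rem j) := by simp [Trans.eff] at hrj; omega
      replace hdj : x₂ (.don j) = x (.don j) := by simp [Trans.eff] at hdj; omega
      simp only [Kind.Rel] at hrel
      simp only [hrj, hdj, hrel, Kind.reward, add_mul, mul_add, one_mul, mul_one] at hadd
      omega
    · replace hrj : x₂ (.rem j) = x (.rem j) := by simp [Trans.eff] at hrj; omega
      replace hdj : x₂ (.don j) = x (.don j) := by simp [Trans.eff] at hdj; omega
      simp only [Kind.Rel] at hrel
      simp only [hrj, hdj, hrel, Kind.reward, add_mul, mul_add, one_mul, mul_one] at hadd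
      omega
    · replace hrj : x (.rem j) = x₂ (.rem j) + 1 := by simp [Trans.eff] at hrj; omega
      replace hdj : x₂ (.don j) = x (.don j) + 1 := by simp [Trans.eff] at hdj; omega
      have := hk rfl
      simp only [Kind.Rel] at hrel
      simp only [hrj, hdj, hrel, Kind.reward, mul_add, one_mul, mul_one, zero_mul] at hadd
      omega
    · replace hrj : x₂ (.rem j) = x (.rem j) := by simp [Trans.eff] at hrj; omega
      replace hdj : x₂ (.don j) = x (.don j) := by simp [Trans.eff] at hdj; omega
      simp only [Kind.Rel] at hrel
      simp only [hrj, hdj, hrel, Kind.reward, mul_add, one_mul, mul_one] at hadd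
      omega
  refine ⟨x₂, h₂, htot.trans hN, hbud, fun i => ?_, fun i => ⟨?_, hrem' i, hdon' i⟩, fun i => ?_,
    by rw [key.2.2, hpot, hbound]⟩
  · by_cases hi : i = j
    · rw [hi, hcj₂]
    · rw [hcnt i hi, hcx, hc i hi]
  · by_cases hi : i = j
    · rw [hi]; exact key.1
    · rw [hrem i hi]; exact hw.trans (hwx i).1
  · by_cases hi : i = j
    · subst hi
      rw [hrem', hdon', htot]
      omega
    · rw [hrem', hdon', htot, hrem i hi, hdon i hi, ← hbal i, (hwx i).2.1, (hwx i).2.2]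

/-- Every run of the machine can be simulated without losing output. -/
theorem Reach.perfect {p : σ} {c : Fin (m + 1) → ℕ} (h : M.Reach n p c) :
    ∃ L, ∀ w, M.Perfect acc n (L + w) (w + n) w p c := by
  suffices ∀ q, ReflTransGen M.Step (M.start, Pi.single 0 n) q →
      ∃ L, ∀ w, M.Perfect acc n (L + w) (w + n) w q.1 q.2 from this _ h
  intro q hq
  induction hq with
  | refl => exact ⟨0, fun w => by simpa using M.perfect_start acc n w⟩
  | tail _ hs ih =>
    obtain ⟨L, ih⟩ := ih
    obtain ⟨k, j, hE, hrel, hc⟩ := hs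
    refine ⟨L + 1, fun w => ?_⟩
    have := ih (w + 1)
    rw [show L + (w + 1) = L + 1 + w by omega, show w + 1 + n = w + n + 1 by omega] at this
    exact this.step hE hrel hc (by omega) (by omega)

/-- A state that can decrement counters and waste time can use up the budget. -/
theorem Perfect.burn {p : σ} (hdec : ∀ j, M.Edge p .dec j p) (hnop : M.Edge p .nop 0 p)
    {N b w : ℕ} {c : Fin (m + 1) → ℕ} (hc : ∑ j, c j ≤ b) (h : M.Perfect acc n N b w p c) :
    M.Perfect acc n N 0 w p 0 := by
  induction b generalizing c with
  | zero =>
    have : c = 0 := by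
      funext j
      exact (Finset.sum_eq_zero_iff.1 (Nat.le_zero.1 hc)) j (Finset.mem_univ j)
    exact this ▸ h
  | succ b ih =>
    by_cases h0 : ∃ j, c j ≠ 0
    · obtain ⟨j, hj⟩ := h0
      refine ih (c := update c j (c j - 1)) ?_
        (h.step (hdec j) ?_ (fun i hi => by simp [hi]) le_rfl (by simp))
      · have := sum_add_eq_sum_add (f := update c j (c j - 1)) (g := c) j
          fun i hi => by simp [hi]
        simp only [update_self] at this
        omega
      · simp only [Kind.Rel, update_self]
        omega
    · push Not at h0
      exact ih (c := c) (by simp [h0]) (h.step hnop rfl (fun _ _ => rfl) le_rfl (by simp))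

theorem Perfect.out {N w : ℕ} {p : σ} (h : M.Perfect acc n N 0 w p 0) :
    ∃ x, M.AnyReach acc n (.loc p) x ∧ x .tot = N ∧ x .out = N * (N + 2 * n) := by
  obtain ⟨x, hx, hN, hb, hc, -, -, hpot⟩ := h
  refine ⟨x, hx, hN, ?_⟩
  simpa [potential, bound, hN, hb, hc] using hpot

variable (M acc n)

/-- All configurations with output below the bound are covered. -/
theorem exists_cover {N : ℕ} (hN : 0 < N) (b : Bool) (B : ℕ) :
    ∃ x, M.NetReach acc n .fin b x ∧ x .tot = N ∧ x .out + 1 = N * (N + 2 * n) ∧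
      ∀ c, c ≠ .tot → c ≠ .out → B ≤ x c := by
  obtain ⟨N, rfl⟩ := Nat.exists_eq_add_one.2 hN
  have h0 := M.perfect_start acc n (N + 1)
  rw [show N + 1 + n = N + n + 1 by omega] at h0
  obtain ⟨x₁, h₁, ht₁, ho₁⟩ := ((h0.step M.start_idle (c' := Pi.single 0 n) rfl
    (fun _ _ => rfl) le_rfl (by simp)).burn M.idle_dec M.idle_nop (by simp)).out
  have hpos : 0 < (N + 1) * (N + 1 + 2 * n) := by positivity
  obtain ⟨x₂, h₂, e₂⟩ := AnyReach.step (t := .give) trivial h₁ (by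
    rintro (_ | _ | _ | i | i | i | i | i) <;> simp [Trans.eff]
    omega)
  have ht₂ : x₂ .tot = x₁ .tot := by simpa [Trans.eff] using e₂ .tot
  have ho₂ : x₂ .out + 1 = x₁ .out := by
    have := e₂ .out
    simp [Trans.eff] at this
    omega
  have hp (c : Comp m) : 0 ≤ Trans.eff (σ := σ) .pump c := by
    cases c <;> simp [Trans.eff]
  have hp' (c : Comp m) (h : c ≠ .tot) (h' : c ≠ .out) : Trans.eff (σ := σ) .pump c = 1 := by
    cases c <;> simp [Trans.eff] at h h' ⊢
  obtain ⟨b', h₂⟩ := h₂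
  obtain ⟨b₃, x₃, h₃, e₃⟩ := Net.Reach.loop (V := M.net) (A := M.trans acc) (t := .pump) trivial rfl B h₂ fun c => by
    have := hp c
    have : 0 ≤ M.net.eff .pump c := this
    positivity
  have ht₃ : x₃ .tot = x₂ .tot := by simpa [net, Trans.eff] using e₃ .tot
  have ho₃ : x₃ .out = x₂ .out := by simpa [net, Trans.eff] using e₃ .out
  have hB (c) (h : c ≠ .tot) (h' : c ≠ .out) : B ≤ x₃ c := by
    have := e₃ c
    have h1 : M.net.eff .pump c = 1 := hp' c h h'
    rw [h1] at this
    omega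
  by_cases hb : b₃ = b
  · subst hb
    exact ⟨x₃, h₃, by omega, by omega, hB⟩
  · have hs := Net.Reach.step (V := M.net) (A := M.trans acc) (t := .pump) trivial h₃
      (x' := fun c => (x₃ c + Trans.eff (σ := σ) .pump c).toNat)
      fun c => Int.toNat_of_nonneg (add_nonneg (by positivity) (hp c))
    have hbb : (!b₃) = b := by revert hb; cases b <;> cases b₃ <;> simp
    rw [hbb] at hs
    refine ⟨_, hs, ?_, ?_, fun c h h' => ?_⟩
    · simp [Trans.eff]
      omega
    · simp [Trans.eff]
      omega
    · have := hB c h h'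
      rw [hp' c h h']
      omega

theorem exists_accept {c : Fin (m + 1) → ℕ} (h : M.Reach n M.halt c) (hacc : acc) :
    ∃ b x, M.NetReach acc n .fin b x ∧ x .out = bound n x := by
  obtain ⟨L, hL⟩ := h.perfect (acc := acc)
  obtain ⟨x, ⟨b, hx⟩, ht, ho⟩ := ((hL (∑ j, c j)).burn M.halt_dec M.halt_nop (by omega)).out
  refine ⟨!b, x, Net.Reach.step (V := M.net) (A := M.trans acc) (t := .accept) hacc hx
    (by simp [net, Trans.eff]), ?_⟩
  rw [ho, bound, ht]

theorem netReach_or {l : Loc m σ} {b : Bool} {x : Comp m → ℕ} (h : M.NetReach True n l b x) :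
    M.NetReach False n l b x ∨ l = .fin := by
  induction h with
  | base => exact .inl .base
  | @step t b x x' ht _ he ih =>
    cases t with
    | accept => exact .inr rfl
    | pump => exact .inr rfl
    | _ =>
      refine .inl (.step ?_ (ih.resolve_right (by simp [net])) he)
      first | exact trivial | exact ht

/-- The refined covers with and without the accepting transition differ if and only if the machine
halts. -/
theorem cover_eq_iff [Finite σ] {d : ℕ} (e : Comp m ⊕ Loc m σ × Bool ≃ Fin d)
    (he : (e (.inl .tot) : ℕ) = 0) :
    (M.net.rep (M.trans True) .gen e (input m n)).Cover1 =
      (M.net.rep (M.trans False) .gen e (input m n)).Cover1 ↔ ¬ ∃ c, M.Reach n M.halt c := by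
  have hsub : M.trans False ⊆ M.trans True := by
    rintro (_ | _) h
    all_goals first | exact trivial | exact h
  rw [Set.Subset.antisymm_iff, and_iff_left (by
    rw [Net.rep_cover_subset _ _ _ _ _ he]
    exact fun q b x hx => ⟨x, hx.mono hsub, rfl, fun _ => le_rfl⟩),
    Net.rep_cover_subset _ _ _ _ _ he]
  constructor
  · rintro h ⟨c, hc⟩
    obtain ⟨b, x, hx, ho⟩ := M.exists_accept True n hc trivial
    obtain ⟨x', hx', ht, hle⟩ := h _ _ _ hx
    obtain ⟨h1, h2⟩ : M.Inv False n x' .fin := NetReach.inv M hx'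
    have hb : bound n x' = bound n x := by simp only [bound, ht]
    have := hle .out
    exact (h2 (by omega)).1
  · intro h l b x hx
    rcases M.netReach_or n hx with hx' | rfl
    · exact ⟨x, hx', rfl, fun _ => le_rfl⟩
    · obtain ⟨h1, h2⟩ : M.Inv True n x .fin := NetReach.inv M hx
      have hlt : x .out < bound n x := lt_of_le_of_ne h1 fun h' => h (h2 h').2
      have hpos : 0 < x .tot := by
        by_contra h0
        simp [bound, Nat.eq_zero_of_not_pos h0] at hlt
      obtain ⟨B, hB⟩ := Finite.exists_le x
      obtain ⟨x', hx', ht, ho, hle⟩ := M.exists_cover False n hpos b B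
      refine ⟨x', hx', ht.symm, fun c => ?_⟩
      by_cases hc : c = .tot
      · rw [hc, ht]
      by_cases hc' : c = .out
      · rw [hc']
        simp only [bound] at hlt
        omega
      · exact (hB c).trans (hle c hc hc')

end Machine

open Nat.Partrec

/-! ### Undecidability -/

/-- A machine halting on exactly the codes of halting computations. -/
theorem exists_universal_machine : ∃ (m : ℕ) (σ : Type) (_ : Finite σ) (M : Machine m σ),
    ∀ n, (∃ s, M.Reach n M.halt s) ↔ (Code.eval (Denumerable.ofNat Code n) 0).Dom := by
  let F (v : List.Vector ℕ 2) : ℕ :=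
    bif (Code.evaln (v.get 1) (Denumerable.ofNat Code (v.get 0)) 0).isSome then 0 else 1
  have hF : Nat.Primrec' F := by
    refine .of_prim (Primrec.cond (Primrec.option_isSome.comp (Code.primrec_evaln.comp
      (((?_ : Primrec _).pair ?_).pair (Primrec.const 0)))) (Primrec.const 0) (Primrec.const 1))
    · exact Primrec.vector_get.comp Primrec.id (Primrec.const 1)
    · exact (Primrec.ofNat Code).comp (Primrec.vector_get.comp Primrec.id (Primrec.const 0))
  have hT : Prog.Testable fun v : Unit → ℕ => ∃ k y, F ⟨[v (), k], rfl⟩ = y ∧ y = 0 := by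
    have h := (((Prog.Testable.of_primrec' hF).rename
      (Option.elim · none ![some (some ()), some none])).and (.eq_zero none)).ex.ex
    exact h
  obtain ⟨P, hP⟩ := hT (fun _ => 0) 1 (by simp)
  refine ⟨_, _, inferInstance, P.machine, fun n => ?_⟩
  rw [Prog.machine_halts_iff]
  have hs (s') := hP (Pi.single 0 n) (fun j hj => Pi.single_eq_of_ne (by omega) _) s'
  simp only [hs, Pi.single_eq_same, exists_eq_left]
  simp only [exists_eq_right, F, List.Vector.get]
  rw [Part.dom_iff_mem]
  simp only [Code.evaln_complete]
  rw [exists_comm]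
  refine exists_congr fun k => ?_
  simp [Option.isSome_iff_exists, Bool.cond_eq_ite]

theorem exists_equiv_fin (α : Type) [Finite α] (a : α) :
    ∃ (d : ℕ) (e : α ≃ Fin d), (e a : ℕ) = 0 := by
  obtain ⟨d, ⟨e⟩⟩ := Finite.exists_equiv_fin α
  have hd : 0 < d := (Nat.zero_le _).trans_lt (e a).2
  exact ⟨d, e.trans (Equiv.swap (e a) ⟨0, hd⟩), by simp⟩

theorem computable_rep {m d : ℕ} {σ T : Type} [Finite T] (V : Net (Comp m) (Loc m σ) T)
    (A : Set T) (q₀ : Loc m σ) (e : Comp m ⊕ Loc m σ × Bool ≃ Fin d) :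
    Computable fun n => V.rep A q₀ e (Machine.input m n) := by
  refine .pair (.const _) (.pair (.const _) (Computable.list_ofFn fun k => ?_))
  rcases e.symm k with (_ | _ | _ | j | _ | _ | _ | _) | p
  case inl.cnt =>
    by_cases hj : j = 0
    · simp only [Net.cfg, Machine.input, hj, Sum.elim_inl, if_true]
      exact Computable.id
    · simpa [Net.cfg, Machine.input, hj] using Computable.const 0
  all_goals first | exact Computable.const _ | exact Computable.id

theorem not_computablePred_cover1_eq :
    ¬ ComputablePred (fun p : VRep × VRep => p.1.Cover1 = p.2.Cover1) := by
  intro h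
  obtain ⟨m, σ, _, M, hM⟩ := exists_universal_machine
  obtain ⟨d, e, he⟩ := exists_equiv_fin (Comp m ⊕ Loc m σ × Bool) (.inl .tot)
  refine ComputablePred.halting_problem 0
    (ComputablePred.computable_of_manyOneReducible ⟨fun c =>
      (M.net.rep (M.trans True) .gen e (Machine.input m (Encodable.encode c)),
        M.net.rep (M.trans False) .gen e (Machine.input m (Encodable.encode c))),
      ((computable_rep ..).comp .encode).pair ((computable_rep ..).comp .encode), fun c => ?_⟩
      h.not)
  rw [M.cover_eq_iff _ e he, hM, Denumerable.ofNat_encode, not_not]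

end CounterVAS

/-- It is undecidable, given two VAS, whether their refined covers with respect to `≤₁`
coincide. -/
theorem stmt_11 :
    ¬ ComputablePred (fun p : VRep × VRep => p.1.Cover1 = p.2.Cover1) :=
  CounterVAS.not_computablePred_cover1_eq
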